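/- Let 𝒜 be an irreducible Coxeter arrangement with Coxeter group W, and let ζ ∈ D(𝒜, −∞)^W be m-universal for a multiplicity m: 𝒜 → ℤ. Then the set {∇_{∂_{P_j}} ∇_D^{−k} ζ : 1 ≤ j ≤ ℓ, k ≥ 0} is linearly independent over T. -/

import Mathlib

/-!
Common setup for formalizing "Primitive derivations, Shi arrangements,
and Bandlow-Musiker-Wagon identities" style results on equivariant
multiplicities of Coxeter arrangements (Abe–Terao).

We work with the polynomial ring `S = ℝ[x_1, …, x_n]` (the symmetric algebra
of `V*` in orthonormal coordinates), its fraction field `F`, and the module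
`Der_F` of ℝ-linear derivations of `F`.  All structures of the paper
(the Coxeter arrangement `𝒜`, the Coxeter group `W` with its actions,
basic invariants, the primitive derivation, the Levi-Civita connection `∇`,
the module `D(𝒜, −∞)` and the modules `D(𝒜, m)`) are packaged, with their
characterizing properties, in the structures `CoxSetup` / `CoxSetup2` below.
-/

open MvPolynomial

noncomputable section

set_option synthInstance.maxHeartbeats 1000000
set_option maxHeartbeats 1000000

/-- `S`: the symmetric algebra of `V*`, i.e. the polynomial ring in the
orthonormal coordinates `x_1, …, x_n` of the `n`-dimensional Euclidean space `V`. -/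
abbrev SS (n : ℕ) : Type := MvPolynomial (Fin n) ℝ

/-- `F`: the quotient field of `S`. -/
abbrev FF (n : ℕ) : Type := FractionRing (SS n)

/-- `Der_F`: the `F`-module of ℝ-linear derivations of `F`. -/
abbrev DerF (n : ℕ) : Type := Derivation ℝ (FF n) (FF n)

variable {n : ℕ}

/-- The canonical embedding `S → F`. -/
def toF (f : SS n) : FF n := algebraMap (SS n) (FF n) f

/-- The coordinate `x_i`, viewed in `F`. -/
def XF (i : Fin n) : FF n := toF (X i)

/-- `f ∈ α^m ⬝ S_{(α)}` inside `F`, where `S_{(α)}` is the localization of `S`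
at the prime ideal `(α)` and `m ∈ ℤ`. -/
def MemLoc (α : SS n) (m : ℤ) (f : FF n) : Prop :=
  ∃ s t : SS n, t ∉ Ideal.span ({α} : Set (SS n)) ∧
    f * toF t = (toF α) ^ m * toF s

/-- `f ∈ F` is homogeneous of degree `d ∈ ℤ` (a quotient of homogeneous
polynomials whose degrees differ by `d`). -/
def HomogF (f : FF n) (d : ℤ) : Prop :=
  ∃ (s t : SS n) (a b : ℕ), t ≠ 0 ∧ s.IsHomogeneous a ∧ t.IsHomogeneous b ∧
    (a : ℤ) - (b : ℤ) = d ∧ f * toF t = toF s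

/-- A derivation `θ ≠ 0` is homogeneous of degree `d`: `θ(α)` is homogeneous of
degree `d` whenever `θ(α) ≠ 0`, for `α ∈ V*` (degree-one forms). -/
def DerHomog (θ : DerF n) (d : ℤ) : Prop :=
  θ ≠ 0 ∧ ∀ p : SS n, p.IsHomogeneous 1 →
    θ (toF p) = 0 ∨ HomogF (θ (toF p)) d

/-- The inner product `I*` on linear forms, in the orthonormal coordinates. -/
def ip1 (p q : SS n) : ℝ :=
  ∑ i, p.coeff (Finsupp.single i 1) * q.coeff (Finsupp.single i 1)

/-- `θ` restricts to a derivation of `S` (an element of `Der_S`). -/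
def IsPolyDer (θ : DerF n) : Prop := ∀ i : Fin n, ∃ s : SS n, θ (XF i) = toF s

/-- Conjugation of a derivation by a field automorphism: `θ ↦ e ∘ θ ∘ e⁻¹`.
This is the natural action of automorphisms on `Der_F`. -/
def conjDer (e : FF n ≃ₐ[ℝ] FF n) (θ : DerF n) : DerF n where
  toLinearMap := e.toLinearMap ∘ₗ θ.toLinearMap ∘ₗ e.symm.toLinearMap
  map_one_eq_zero' := by
    simp [Derivation.map_one_eq_zero]
  leibniz' := by
    intro a b
    have h : e.symm (a * b) = e.symm a * e.symm b := map_mul _ _ _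
    simp only [LinearMap.coe_comp, Function.comp_apply, AlgEquiv.toLinearMap_apply,
      Derivation.coeFn_coe, h, Derivation.leibniz, smul_eq_mul, map_add, map_mul,
      AlgEquiv.apply_symm_apply]

/-- The index of the top-degree basic invariant. -/
def lastIdx (n : ℕ) (hn : 0 < n) : Fin n := ⟨n - 1, Nat.sub_lt hn Nat.one_pos⟩

/-- Integer iterates of a map `f` whose inverse (on the relevant set) is `g`. -/
def zpowIter {X : Type*} (f g : X → X) : ℤ → X → X
  | Int.ofNat k => f^[k]
  | Int.negSucc k => g^[k + 1]

/-- `Θ` is a basis of the set `M ⊆ Der_F` over the subring of `S` given by the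
set of coefficients `Coef` (e.g. `Coef = Set.univ` for an `S`-basis, `Coef = R`
for an `R`-basis, `Coef = T` for a `T`-basis). -/
def isBasisOver {ι : Type*} (Coef : Set (SS n)) (Θ : ι → DerF n)
    (M : Set (DerF n)) : Prop :=
  (∀ i, Θ i ∈ M) ∧
  (∀ c : ι →₀ SS n, (∀ i, c i ∈ Coef) →
    (c.sum fun i f => toF f • Θ i) = 0 → c = 0) ∧
  (∀ δ ∈ M, ∃ c : ι →₀ SS n, (∀ i, c i ∈ Coef) ∧
    δ = c.sum fun i f => toF f • Θ i)

/-- `θ_1, …, θ_n` is an `S`-basis of the set `M ⊆ Der_F`. -/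
def IsSBasis {ι : Type*} [Fintype ι] (Θ : ι → DerF n) (M : Set (DerF n)) : Prop :=
  (∀ i, Θ i ∈ M) ∧
  (∀ c : ι → SS n, (∑ i, toF (c i) • Θ i) = 0 → ∀ i, c i = 0) ∧
  (∀ δ ∈ M, ∃ c : ι → SS n, δ = ∑ i, toF (c i) • Θ i)

/-- An `n`-dimensional irreducible Coxeter arrangement `𝒜` (hyperplanes indexed
by `hyp`, with defining linear forms `α`), together with its Coxeter group `W`
(acting orthogonally on `V`, hence on `S`, on `F` and on hyperplanes), a set of
basic invariants `P_1, …, P_n` of degrees `d_1 ≤ … ≤ d_n = h`, the partial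
derivatives `∂/∂x_i` and `∂/∂P_i` (so `D = ∂/∂P_n` is a primitive derivation),
the Euler derivation `E`, the Levi-Civita connection `∇` of the flat metric `I`,
the module `D(𝒜, −∞)` of Abe–Terao, and the inverse of the `T`-linear
automorphism `∇_D` of `D(𝒜, −∞)^W`. -/
structure CoxSetup (n : ℕ) (hn : 0 < n) (hyp W : Type)
    [Fintype hyp] [Group W] [Fintype W] : Type where
  hypNe : Nonempty hyp
  /-- the defining linear forms of the hyperplanes -/
  α : hyp → SS n
  α_ne : ∀ H, α H ≠ 0
  α_hom : ∀ H, (α H).IsHomogeneous 1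
  α_red : ∀ H H' : hyp, (∃ c : ℝ, c ≠ 0 ∧ α H = c • α H') → H = H'
  /-- the action of `W` on `S` by graded `ℝ`-algebra automorphisms -/
  actS : W →* (SS n ≃ₐ[ℝ] SS n)
  actS_lin : ∀ (w : W) (p : SS n), p.IsHomogeneous 1 → (actS w p).IsHomogeneous 1
  /-- `W` acts orthogonally -/
  actS_orth : ∀ (w : W) (p q : SS n), p.IsHomogeneous 1 → q.IsHomogeneous 1 →
      ip1 (actS w p) (actS w q) = ip1 p q
  actS_faithful : ∀ w : W, (∀ f, actS w f = f) → w = 1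
  /-- the action of `W` on the set of hyperplanes -/
  σ : W →* Equiv.Perm hyp
  σ_compat : ∀ (w : W) (H : hyp), ∃ c : ℝ, c ≠ 0 ∧ actS w (α H) = c • α (σ w H)
  /-- the orthogonal reflection through each hyperplane of `𝒜` -/
  reflW : hyp → W
  reflW_α : ∀ H, actS (reflW H) (α H) = - α H
  reflW_fix : ∀ (H) (p : SS n), p.IsHomogeneous 1 → ip1 p (α H) = 0 →
      actS (reflW H) p = p
  /-- `W` is generated by the reflections -/
  W_gen : Subgroup.closure (Set.range reflW) = (⊤ : Subgroup W)
  /-- `𝒜` is the full reflection arrangement of `W` -/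
  hyp_all : ∀ (w : W) (p : SS n), p.IsHomogeneous 1 → p ≠ 0 → actS w p = -p →
      (∀ q : SS n, q.IsHomogeneous 1 → ip1 p q = 0 → actS w q = q) →
      ∃ (H : hyp) (c : ℝ), c ≠ 0 ∧ p = c • α H
  /-- irreducibility: `W` acts irreducibly on `V*` -/
  irred : ∀ U : Submodule ℝ (SS n), U ≤ Submodule.span ℝ (Set.range X) →
      (∀ (w : W), ∀ p ∈ U, actS w p ∈ U) →
      U = ⊥ ∨ U = Submodule.span ℝ (Set.range X)
  /-- the induced action of `W` on the quotient field `F` -/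
  actF : W →* (FF n ≃ₐ[ℝ] FF n)
  actF_compat : ∀ (w : W) (f : SS n), actF w (toF f) = toF (actS w f)
  /-- basic invariants `P_1, …, P_n` of `W`, of degrees `d_1 ≤ … ≤ d_n = h` -/
  P : Fin n → SS n
  d : Fin n → ℕ
  d_mono : Monotone d
  d_pos : ∀ i, 0 < d i
  P_hom : ∀ i, (P i).IsHomogeneous (d i)
  P_inv : ∀ (w : W) (i : Fin n), actS w (P i) = P i
  P_indep : AlgebraicIndependent ℝ P
  P_gen : ∀ f : SS n, (∀ w : W, actS w f = f) → f ∈ Algebra.adjoin ℝ (Set.range P)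
  /-- the partial derivatives `∂/∂x_i`, as derivations of `F` -/
  dX : Fin n → DerF n
  dX_eq : ∀ i j, dX i (XF j) = if i = j then 1 else 0
  /-- the partial derivatives `∂/∂P_i`, as derivations of `F`;
  `∂/∂P_n` is the primitive derivation `D` -/
  dP : Fin n → DerF n
  dP_eq : ∀ i j, dP i (toF (P j)) = if i = j then 1 else 0
  /-- the Euler derivation -/
  Eul : DerF n
  Eul_eq : ∀ i, Eul (XF i) = XF i
  /-- the Levi-Civita connection of the flat metric `I`, characterized in the
  orthonormal coordinates by `(∇_θ δ)(x_i) = θ(δ(x_i))` -/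
  nabla : DerF n → DerF n → DerF n
  nabla_eq : ∀ (θ δ : DerF n) (i : Fin n), nabla θ δ (XF i) = θ (δ (XF i))
  /-- the module `D(𝒜, −∞) = I*(Ω¹(𝒜, ∞))` of Abe–Terao -/
  Dinf : Set (DerF n)
  Dinf_zero : (0 : DerF n) ∈ Dinf
  Dinf_add : ∀ θ δ, θ ∈ Dinf → δ ∈ Dinf → θ + δ ∈ Dinf
  Dinf_smul : ∀ (f : SS n) (θ), θ ∈ Dinf → toF f • θ ∈ Dinf
  Dinf_poly : ∀ θ : DerF n, IsPolyDer θ → θ ∈ Dinf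
  Dinf_stab : ∀ (w : W) (θ), θ ∈ Dinf → conjDer (actF w) θ ∈ Dinf
  /-- the inverse of the `T`-linear automorphism
  `∇_D : D(𝒜, −∞)^W → D(𝒜, −∞)^W` ([AT08, AT09]) -/
  nablaDinv : DerF n → DerF n
  nablaDinv_spec : ∀ θ : DerF n, θ ∈ Dinf → (∀ w : W, conjDer (actF w) θ = θ) →
      nablaDinv θ ∈ Dinf ∧ (∀ w : W, conjDer (actF w) (nablaDinv θ) = nablaDinv θ) ∧
      nabla (dP (lastIdx n hn)) (nablaDinv θ) = θ ∧
      nablaDinv (nabla (dP (lastIdx n hn)) θ) = θ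

variable {hn : 0 < n} {hyp W : Type} [Fintype hyp] [Group W] [Fintype W]

/-- The natural action of `w ∈ W` on `Der_F`. -/
def actDer (C : CoxSetup n hn hyp W) (w : W) (θ : DerF n) : DerF n :=
  conjDer (C.actF w) θ

/-- `θ` is `W`-invariant. -/
def invDer (C : CoxSetup n hn hyp W) (θ : DerF n) : Prop :=
  ∀ w : W, actDer C w θ = θ

/-- The module `D(𝒜, m)` attached to a multiplicity `m : 𝒜 → ℤ`. -/
def Dmod (C : CoxSetup n hn hyp W) (m : hyp → ℤ) : Set (DerF n) :=
  {θ | θ ∈ C.Dinf ∧ ∀ H : hyp, MemLoc (C.α H) (m H) (θ (toF (C.α H)))}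

/-- The `W`-invariant part `D(𝒜, m)^W`. -/
def DmodW (C : CoxSetup n hn hyp W) (m : hyp → ℤ) : Set (DerF n) :=
  {θ | θ ∈ Dmod C m ∧ invDer C θ}

/-- The invariant ring `R = S^W`. -/
def Rinv (C : CoxSetup n hn hyp W) : Set (SS n) :=
  {f | ∀ w : W, C.actS w f = f}

/-- The primitive derivation `D = ∂/∂P_n`. -/
def Dprim (C : CoxSetup n hn hyp W) : DerF n := C.dP (lastIdx n hn)

/-- `T = {f ∈ R | D f = 0} = ℝ[P_1, …, P_{n-1}]`. -/
def Tker (C : CoxSetup n hn hyp W) : Set (SS n) :=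
  {f | f ∈ Rinv C ∧ Dprim C (toF f) = 0}

/-- `ζ` is `m`-universal : `ζ` is a homogeneous `W`-invariant element of
`D(𝒜, −∞)` and `Ψ_ζ : Der_S → D(𝒜, 2m)`, `θ ↦ ∇_θ ζ`, is bijective. -/
def isUniversal (C : CoxSetup n hn hyp W) (m : hyp → ℤ) (ζ : DerF n) : Prop :=
  ζ ∈ C.Dinf ∧ invDer C ζ ∧ (∃ dg : ℤ, DerHomog ζ dg) ∧
  Set.BijOn (fun θ => C.nabla θ ζ) {θ | IsPolyDer θ}
    (Dmod C fun H => 2 * m H)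

/-- The equivariant odd multiplicity `m*` associated to an arbitrary
multiplicity `m`: `m*(H) = max_{w ∈ W} (2⌊m(wH)/2⌋ + 1)`. -/
def mstar (C : CoxSetup n hn hyp W) (m : hyp → ℤ) : hyp → ℤ :=
  fun H => Finset.univ.sup' ⟨1, Finset.mem_univ 1⟩
    (fun w : W => 2 * Int.fdiv (m (C.σ w H)) 2 + 1)

/-- A `CoxSetup` whose arrangement decomposes into exactly two `W`-orbits
`𝒜 = 𝒜₁ ∪ 𝒜₂` (`orb H = true` iff `H ∈ 𝒜₁`), with basic invariants
`P^{(i)}_1, …, P^{(i)}_n` of the reflection groups `W_i` of `𝒜_i` (generated by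
the reflections through the hyperplanes of `𝒜_i`), the partial derivatives
`∂/∂P^{(i)}_j`, so that `D₁ = ∂/∂P^{(1)}_n` is a primitive derivation for `𝒜₁`,
assumed to be `W`-invariant; together with the module `D(𝒜₁, −∞)` and the
inverse of the `T₁`-linear automorphism `∇_{D₁}` of `D(𝒜₁, −∞)^{W₁}`. -/
structure CoxSetup2 (n : ℕ) (hn : 0 < n) (hyp W : Type)
    [Fintype hyp] [Group W] [Fintype W] extends CoxSetup n hn hyp W : Type where
  /-- the orbit decomposition `𝒜 = 𝒜₁ ∪ 𝒜₂`: `orb H = true` iff `H ∈ 𝒜₁` -/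
  orb : hyp → Bool
  orb_equiv : ∀ (w : W) (H : hyp), orb (σ w H) = orb H
  orb_trans : ∀ H H' : hyp, orb H = orb H' → ∃ w : W, σ w H = H'
  orb_ne1 : ∃ H, orb H = true
  orb_ne2 : ∃ H, orb H = false
  /-- basic invariants of `W₁`, of degrees `d^{(1)}_1 ≤ … ≤ d^{(1)}_n = h₁` -/
  P1 : Fin n → SS n
  d1 : Fin n → ℕ
  d1_mono : Monotone d1
  d1_pos : ∀ i, 0 < d1 i
  P1_hom : ∀ i, (P1 i).IsHomogeneous (d1 i)
  P1_inv : ∀ (H : hyp), orb H = true → ∀ i, actS (reflW H) (P1 i) = P1 i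
  P1_indep : AlgebraicIndependent ℝ P1
  P1_gen : ∀ f : SS n, (∀ H : hyp, orb H = true → actS (reflW H) f = f) →
      f ∈ Algebra.adjoin ℝ (Set.range P1)
  /-- basic invariants of `W₂`, of degrees `d^{(2)}_1 ≤ … ≤ d^{(2)}_n = h₂` -/
  P2 : Fin n → SS n
  d2 : Fin n → ℕ
  d2_mono : Monotone d2
  d2_pos : ∀ i, 0 < d2 i
  P2_hom : ∀ i, (P2 i).IsHomogeneous (d2 i)
  P2_inv : ∀ (H : hyp), orb H = false → ∀ i, actS (reflW H) (P2 i) = P2 i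
  P2_indep : AlgebraicIndependent ℝ P2
  P2_gen : ∀ f : SS n, (∀ H : hyp, orb H = false → actS (reflW H) f = f) →
      f ∈ Algebra.adjoin ℝ (Set.range P2)
  /-- the partial derivatives `∂/∂P^{(1)}_j`; `D₁ = ∂/∂P^{(1)}_n` is a
  primitive derivation corresponding to the orbit `𝒜₁` -/
  dP1 : Fin n → DerF n
  dP1_eq : ∀ i j, dP1 i (toF (P1 j)) = if i = j then 1 else 0
  /-- the partial derivatives `∂/∂P^{(2)}_j` -/
  dP2 : Fin n → DerF n
  dP2_eq : ∀ i j, dP2 i (toF (P2 j)) = if i = j then 1 else 0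
  /-- the primitive derivation `D₁` is `W`-invariant -/
  D1_Winv : ∀ w : W, conjDer (actF w) (dP1 (lastIdx n hn)) = dP1 (lastIdx n hn)
  /-- the module `D(𝒜₁, −∞)` -/
  Dinf1 : Set (DerF n)
  Eul_mem1 : Eul ∈ Dinf1
  /-- the inverse of the `T₁`-linear automorphism
  `∇_{D₁} : D(𝒜₁, −∞)^{W₁} → D(𝒜₁, −∞)^{W₁}` ([AT09]) -/
  nablaD1inv : DerF n → DerF n
  nablaD1inv_spec : ∀ θ : DerF n, θ ∈ Dinf1 →
      (∀ H : hyp, orb H = true → conjDer (actF (reflW H)) θ = θ) →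
      nablaD1inv θ ∈ Dinf1 ∧
      (∀ H : hyp, orb H = true →
        conjDer (actF (reflW H)) (nablaD1inv θ) = nablaD1inv θ) ∧
      nabla (dP1 (lastIdx n hn)) (nablaD1inv θ) = θ ∧
      nablaD1inv (nabla (dP1 (lastIdx n hn)) θ) = θ

/-- The primitive derivation `D₁` corresponding to the orbit `𝒜₁`. -/
def D1prim (C : CoxSetup2 n hn hyp W) : DerF n := C.dP1 (lastIdx n hn)

/-- The derivation `E^{(p,q)} = ∇_D^{−q} ∇_{D₁}^{q−p} E`. -/
def EulPQ (C : CoxSetup2 n hn hyp W) (p q : ℤ) : DerF n :=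
  zpowIter (C.nabla (Dprim C.toCoxSetup)) C.nablaDinv (-q)
    (zpowIter (C.nabla (D1prim C)) C.nablaD1inv (q - p) C.Eul)

/-- The multiplicity `(m₁, m₂)` taking the constant value `m₁` on `𝒜₁` and
`m₂` on `𝒜₂`. -/
def multTwo (C : CoxSetup2 n hn hyp W) (m1 m2 : ℤ) : hyp → ℤ :=
  fun H => cond (C.orb H) m1 m2

/-- The Coxeter number `h₁` of `W₁`. -/
def cox1 (C : CoxSetup2 n hn hyp W) : ℤ := (C.d1 (lastIdx n hn) : ℤ)

/-- The Coxeter number `h₂` of `W₂`. -/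
def cox2 (C : CoxSetup2 n hn hyp W) : ℤ := (C.d2 (lastIdx n hn) : ℤ)

/-- `θ_i^{(p,q)} := ∇_{∂/∂P_i} E^{(p,q)}`. -/
def thetaPQ (C : CoxSetup2 n hn hyp W) (i : Fin n) (p q : ℤ) : DerF n :=
  C.nabla (C.dP i) (EulPQ C p q)

/-- `𝒢^{(p,q)} = ⊕_{i=1}^n T·θ_i^{(p,q)}`. -/
def GmodPQ (C : CoxSetup2 n hn hyp W) (p q : ℤ) : Set (DerF n) :=
  {θ | ∃ c : Fin n → SS n, (∀ i, c i ∈ Tker C.toCoxSetup) ∧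
    θ = ∑ i, toF (c i) • thetaPQ C i p q}


/-- `𝒢^{(k)}`: the `T`-span of `∇_{∂/∂P_1} ∇_D^{−k} ζ, …, ∇_{∂/∂P_n} ∇_D^{−k} ζ`. -/
def GmodK (C : CoxSetup n hn hyp W) (ζ : DerF n) (k : ℕ) : Set (DerF n) :=
  {θ | ∃ c : Fin n → SS n, (∀ i, c i ∈ Tker C) ∧
    θ = ∑ i, toF (c i) • C.nabla (C.dP i) (C.nablaDinv^[k] ζ)}

/-- The sum `Σ_{k ≥ 0} 𝒢^{(k)} ⊆ Der_F`. -/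
def sumGmod (C : CoxSetup n hn hyp W) (ζ : DerF n) : Set (DerF n) :=
  {θ | ∃ (N : ℕ) (g : ℕ → DerF n), (∀ k, g k ∈ GmodK C ζ k) ∧
    θ = ∑ k ∈ Finset.range N, g k}

section Helpers

section Growth

open Polynomial IntermediateField WithZero

variable {K F : Type*} [Field K] [Field F] [Algebra K F]

theorem Valuation.algebraMap_eq_one_of_le {Γ : Type*} [LinearOrderedCommGroupWithZero Γ]
    (v : Valuation F Γ) (hK : ∀ c : K, v (algebraMap K F c) ≤ 1) {c : K} (hc : c ≠ 0) :
    v (algebraMap K F c) = 1 := by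
  refine le_antisymm (hK c) ?_
  by_contra h
  push Not at h
  have h1 := hK c⁻¹
  have h2 : v (algebraMap K F c) * v (algebraMap K F c⁻¹) = 1 := by
    rw [← map_mul, ← map_mul, mul_inv_cancel₀ hc, map_one, map_one]
  exact absurd h2 (mul_lt_one_of_lt_of_le h h1).ne

theorem Valuation.aeval_le_one {Γ : Type*} [LinearOrderedCommGroupWithZero Γ]
    (v : Valuation F Γ) (hK : ∀ c : K, v (algebraMap K F c) ≤ 1) {u : F} (hu : v u ≤ 1)
    (p : K[X]) : v (aeval u p) ≤ 1 := by
  rw [aeval_eq_sum_range]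
  refine v.map_sum_le fun i _ => ?_
  rw [Algebra.smul_def, map_mul, map_pow]
  exact mul_le_one' (hK _) (pow_le_one' hu i)

/-- A unit whose residue is algebraic over `K` is a root, modulo the maximal ideal, of a
separable polynomial. -/
theorem exists_simple_root_mod [CharZero K] {Γ : Type*} [LinearOrderedCommGroupWithZero Γ]
    (v : Valuation F Γ) (hK : ∀ c : K, v (algebraMap K F c) ≤ 1) {u : F} (hu : v u ≤ 1)
    (h : ∃ p : K[X], p ≠ 0 ∧ v (aeval u p) < 1) :
    ∃ p : K[X], v (aeval u p) < 1 ∧ v (aeval u (derivative p)) = 1 := by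
  classical
  have hex : ∃ d : ℕ, ∃ p : K[X], p ≠ 0 ∧ p.natDegree = d ∧ v (aeval u p) < 1 := by
    obtain ⟨p, h1, h2⟩ := h
    exact ⟨_, p, h1, rfl, h2⟩
  obtain ⟨p, hp0, hpd, hpv⟩ := Nat.find_spec hex
  have hdeg : p.natDegree ≠ 0 := by
    intro h0
    obtain ⟨c, rfl⟩ := natDegree_eq_zero.1 h0
    have hc : c ≠ 0 := by rintro rfl; simp at hp0
    rw [Polynomial.aeval_C, v.algebraMap_eq_one_of_le hK hc] at hpv
    exact lt_irrefl _ hpv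
  refine ⟨p, hpv, le_antisymm (v.aeval_le_one hK hu _) ?_⟩
  by_contra hlt
  push Not at hlt
  have hne : derivative p ≠ 0 := fun h0 => hdeg (derivative_eq_zero.1 h0)
  have hle := Nat.find_min' hex ⟨derivative p, hne, rfl, hlt⟩
  have := natDegree_derivative_lt hdeg
  omega

variable (v : Valuation F ℤᵐ⁰) (θ : Derivation K F F)

theorem Derivation.logDeriv_pow {f : F} (hf : f ≠ 0) (k : ℕ) :
    θ (f ^ k) / f ^ k = k * (θ f / f) := by
  rw [Derivation.leibniz_pow]
  cases k with
  | zero => simp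
  | succ k => simp only [Nat.add_sub_cancel, nsmul_eq_mul, smul_eq_mul]; field_simp; ring

theorem Derivation.logDeriv_mul {f g : F} (hf : f ≠ 0) (hg : g ≠ 0) :
    θ (f * g) / (f * g) = θ f / f + θ g / g := by
  rw [Derivation.leibniz]; simp only [smul_eq_mul]; field_simp; ring

theorem Derivation.logDeriv_inv {f : F} (hf : f ≠ 0) : θ f⁻¹ / f⁻¹ = -(θ f / f) := by
  rw [Derivation.leibniz_inv]; simp only [smul_eq_mul]; field_simp

theorem Derivation.logDeriv_zpow {f : F} (hf : f ≠ 0) (k : ℤ) :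
    θ (f ^ k) / f ^ k = k * (θ f / f) := by
  cases k with
  | ofNat k => simpa using θ.logDeriv_pow hf k
  | negSucc k =>
    rw [zpow_negSucc, θ.logDeriv_inv (pow_ne_zero _ hf), θ.logDeriv_pow hf]; push_cast; ring

theorem logDeriv_le_of_units [CharZero K] (hK : ∀ c : K, v (algebraMap K F c) ≤ 1)
    {s : F} (hs0 : s ≠ 0)
    (hs : v s < 1) (hθ : θ s = -s) {C : ℤᵐ⁰} (hC : ∀ u, v u = 1 → v (θ u) ≤ C) {f : F}
    (hf : f ≠ 0) : v (θ f / f) ≤ max C 1 := by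
  have : CharZero F := charZero_of_injective_algebraMap (algebraMap K F).injective
  set q := (log (v s)).natAbs with hq
  set p := log (v f) with hp
  have hvs : v s ≠ 0 := by simpa using hs0
  have hvf : v f ≠ 0 := by simpa using hf
  have hlt : log (v s) < 0 := by rw [log_lt_iff_lt_exp hvs]; simpa using hs
  have hq0 : q ≠ 0 := by omega
  have hs' : v s = exp (-(q : ℤ)) := by
    rw [← exp_log hvs]; congr 1; omega
  have hf' : v f = exp p := (exp_log hvf).symm
  have hu : v (f ^ q * s ^ p) = 1 := by
    rw [map_mul, map_pow, map_zpow₀, hs', hf', ← exp_nsmul, ← exp_zsmul, ← exp_add, ← exp_zero]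
    congr 1
    simp; ring
  have h1 := θ.logDeriv_mul (pow_ne_zero q hf) (zpow_ne_zero p hs0)
  rw [θ.logDeriv_pow hf, θ.logDeriv_zpow hs0, hθ, neg_div, div_self hs0] at h1
  have h2 : v (θ (f ^ q * s ^ p) / (f ^ q * s ^ p)) ≤ C := by
    rw [map_div₀, hu, div_one]; exact hC _ hu
  have h3 : (q : F) * (θ f / f) = θ (f ^ q * s ^ p) / (f ^ q * s ^ p) + p := by rw [h1]; ring
  have hvq : v (q : F) = 1 := by
    have := v.algebraMap_eq_one_of_le hK (c := (q : K)) (by exact_mod_cast hq0)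
    simpa using this
  have hvp : v (p : F) ≤ 1 := by simpa using hK (p : K)
  calc v (θ f / f) = v ((q : F) * (θ f / f)) := by rw [map_mul, hvq, one_mul]
    _ ≤ max C 1 := by
        rw [h3]; exact (v.map_add _ _).trans (max_le_max h2 hvp)

/-- A derivation with `θ s = -s` that is bounded on units does not increase the valuation, as soon
as the residue field is algebraic over the field of constants. -/
theorem derivation_valuation_le [CharZero K] (hK : ∀ c : K, v (algebraMap K F c) ≤ 1)
    {s : F} (hs0 : s ≠ 0) (hs : v s < 1) (hθ : θ s = -s) (A : Subring F)
    (hres : ∀ u ∈ A, v u = 1 → ∃ p : K[X], p ≠ 0 ∧ v (aeval u p) < 1)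
    (hfrac : ∀ u, v u = 1 → ∃ a ∈ A, ∃ b ∈ A, v a = 1 ∧ v b = 1 ∧ u = a / b)
    {C : ℤᵐ⁰} (hC : ∀ u, v u = 1 → v (θ u) ≤ C) (f : F) : v (θ f) ≤ v f := by
  have step : ∀ c : ℕ, (∀ u, v u = 1 → v (θ u) ≤ exp ((c : ℤ) + 1)) →
      ∀ u, v u = 1 → v (θ u) ≤ exp (c : ℤ) := by
    intro c hc
    have hA : ∀ u ∈ A, v u = 1 → v (θ u) ≤ exp (c : ℤ) := by
      intro u hu hu1
      obtain ⟨p, hp1, hp2⟩ := exists_simple_root_mod v hK hu1.le (hres u hu hu1)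
      have h1 : θ (aeval u p) = aeval u (derivative p) * θ u := by
        rw [Derivation.map_aeval, smul_eq_mul]
      have h2 : v (θ u) = v (θ (aeval u p)) := by rw [h1, map_mul, hp2, one_mul]
      rw [h2]
      rcases eq_or_ne (aeval u p) 0 with h0 | h0
      · rw [h0, map_zero, map_zero]; exact zero_le
      · have h3 := logDeriv_le_of_units v θ hK hs0 hs hθ hc h0
        have h4 : max (exp ((c : ℤ) + 1)) 1 = exp ((c : ℤ) + 1) := by
          apply max_eq_left; rw [← exp_zero, exp_le_exp]; omega
        rw [h4] at h3
        have h5 : v (aeval u p) ≤ exp (-1) := by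
          have : v (aeval u p) ≠ 0 := by simpa using h0
          rw [← exp_log this, exp_le_exp]
          have : log (v (aeval u p)) < 0 := by rw [log_lt_iff_lt_exp this]; simpa using hp1
          omega
        have h6 : θ (aeval u p) = θ (aeval u p) / aeval u p * aeval u p := by field_simp
        rw [h6, map_mul]
        calc _ ≤ exp ((c : ℤ) + 1) * exp (-1) := mul_le_mul' h3 h5
          _ = _ := by rw [← exp_add]; congr 1; omega
    intro u hu
    obtain ⟨a, ha, b, hb, ha1, hb1, rfl⟩ := hfrac u hu
    have ha0 : a ≠ 0 := by rintro rfl; simp at ha1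
    have hb0 : b ≠ 0 := by rintro rfl; simp at hb1
    have h1 : θ (a / b) = (a / b) * (θ a / a - θ b / b) := by
      have := θ.logDeriv_mul ha0 (inv_ne_zero hb0)
      rw [θ.logDeriv_inv hb0, ← div_eq_mul_inv, div_eq_iff (div_ne_zero ha0 hb0)] at this
      rw [this]; ring
    rw [h1, map_mul, hu, one_mul]
    refine (v.map_sub _ _).trans (max_le ?_ ?_)
    · rw [map_div₀, ha1, div_one]; exact hA a ha ha1
    · rw [map_div₀, hb1, div_one]; exact hA b hb hb1
  have base : ∃ c : ℕ, ∀ u, v u = 1 → v (θ u) ≤ exp (c : ℤ) := by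
    refine ⟨(log C).toNat, fun u hu => (hC u hu).trans ?_⟩
    rcases eq_or_ne C 0 with rfl | h0
    · exact zero_le
    · conv_lhs => rw [← exp_log h0]
      rw [exp_le_exp]; omega
  obtain ⟨c, hc⟩ := base
  have key : ∀ u, v u = 1 → v (θ u) ≤ 1 := by
    induction c with
    | zero => simpa using hc
    | succ c ih => exact ih (step c (by exact_mod_cast hc))
  rcases eq_or_ne f 0 with rfl | h0
  · simp
  · have h3 := logDeriv_le_of_units v θ hK hs0 hs hθ key h0
    rw [max_self, map_div₀, div_le_one₀ (by simpa [zero_lt_iff] using h0)] at h3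
    exact h3

open scoped algebraAdjoinAdjoin in
/-- For a derivation `D` with `D t = 1` over a field of constants `K`, and `F` finite over `K(t)`,
there is a place at infinity along which `D` decreases the order of growth. -/
theorem exists_valuation_at_infinity [CharZero K] (D : Derivation K F F) {t : F} (ht : D t = 1)
    [FiniteDimensional K⟮t⁻¹⟯ F] :
    ∃ v : Valuation F ℤᵐ⁰, (∀ c : K, v (algebraMap K F c) ≤ 1) ∧ 1 < v t ∧
      ∀ f, v (D f) * v t ≤ v f := by
  have : CharZero F := charZero_of_injective_algebraMap (algebraMap K F).injective
  have ht0 : t ≠ 0 := by rintro rfl; simp at ht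
  set s := t⁻¹ with hs_def
  have hs0 : s ≠ 0 := inv_ne_zero ht0
  set θ : Derivation K F F := t • D with hθ_def
  have hθs : θ s = -s := by
    rw [hθ_def, Derivation.smul_apply, hs_def, Derivation.leibniz_inv, ht]
    simp only [smul_eq_mul]; field_simp
  have htrans : ∀ p : K[X], aeval s p = 0 → p = 0 := by
    by_contra! hex
    classical
    have hex' : ∃ d : ℕ, ∃ p : K[X], aeval s p = 0 ∧ p ≠ 0 ∧ p.natDegree = d := by
      obtain ⟨p, h1, h2⟩ := hex
      exact ⟨_, p, h1, h2, rfl⟩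
    obtain ⟨p, hp1, hp0, hpd⟩ := Nat.find_spec hex'
    have hdeg : p.natDegree ≠ 0 := by
      intro h0
      obtain ⟨c, rfl⟩ := natDegree_eq_zero.1 h0
      rw [Polynomial.aeval_C, map_eq_zero] at hp1
      exact hp0 (by rw [hp1, map_zero])
    have h1 : aeval s (derivative p) = 0 := by
      have h2 : θ (aeval s p) = 0 := by rw [hp1, map_zero]
      rw [Derivation.map_aeval, hθs, smul_eq_mul, mul_neg, neg_eq_zero] at h2
      exact (mul_eq_zero.1 h2).resolve_right hs0
    have hne : derivative p ≠ 0 := fun h0 => hdeg (derivative_eq_zero.1 h0)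
    have hle := Nat.find_min' hex' ⟨derivative p, h1, hne, rfl⟩
    have := natDegree_derivative_lt hdeg
    omega
  let B := Algebra.adjoin K {s}
  have hBmem : ∀ b : F, b ∈ B ↔ ∃ p : K[X], aeval s p = b := fun b => by
    change b ∈ Algebra.adjoin K {s} ↔ _
    rw [Algebra.adjoin_singleton_eq_range_aeval]; rfl
  have : IsPrincipalIdealRing B := by
    let φ : K[X] →ₐ[K] B := aeval ⟨s, Algebra.self_mem_adjoin_singleton K s⟩
    refine IsPrincipalIdealRing.of_surjective φ.toRingHom fun b => ?_
    obtain ⟨p, hp⟩ := (hBmem b).1 b.2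
    refine ⟨p, Subtype.ext ?_⟩
    have : ((φ p : B) : F) = aeval s p := by
      have := aeval_algHom_apply B.val (⟨s, Algebra.self_mem_adjoin_singleton K s⟩ : B) p
      exact this.symm
    exact this.trans hp
  have : Algebra.IsSeparable K⟮s⟯ F := Algebra.IsAlgebraic.isSeparable_of_perfectField
  let A := integralClosure B F
  have : IsDedekindDomain A := integralClosure.isDedekindDomain B K⟮s⟯ F
  have : IsFractionRing A F := integralClosure.isFractionRing_of_finite_extension K⟮s⟯ F
  have hfin : Module.Finite B A := IsIntegralClosure.finite B K⟮s⟯ F A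
  have hsB : s ∈ B := Algebra.self_mem_adjoin_singleton K s
  let sA : A := algebraMap B A ⟨s, hsB⟩
  have hsA : (sA : F) = s := rfl
  have hnu : ¬ IsUnit sA := by
    intro h
    have h1 : IsUnit (⟨s, hsB⟩ : B) := isUnit_of_map_unit (algebraMap B A) _ h
    obtain ⟨b, hb⟩ := h1.exists_right_inv
    obtain ⟨p, hp⟩ := (hBmem b).1 b.2
    have h2 : s * aeval s p = 1 := by rw [hp]; exact congrArg Subtype.val hb
    have h3 : Polynomial.X * p - 1 = 0 := htrans _ (by simp [h2])
    have h4 := congrArg (Polynomial.eval 0) h3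
    simp at h4
  obtain ⟨𝔪, h𝔪, hs𝔪⟩ := exists_max_ideal_of_mem_nonunits hnu
  let w : IsDedekindDomain.HeightOneSpectrum A :=
    ⟨𝔪, h𝔪.isPrime, fun h => hs0 (by rw [h, Ideal.mem_bot] at hs𝔪; rw [← hsA, hs𝔪]; rfl)⟩
  let v := w.valuation F
  have hvA : ∀ a : A, v (a : F) ≤ 1 := fun a => w.valuation_le_one a
  have hvB : ∀ b : F, b ∈ B → v b ≤ 1 := fun b hb => hvA (algebraMap B A ⟨b, hb⟩)
  have hK : ∀ c : K, v (algebraMap K F c) ≤ 1 := fun c => hvB _ (B.algebraMap_mem c)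
  have hvs : v s < 1 := (w.valuation_lt_one_iff_mem sA).2 hs𝔪
  have hθB : ∀ b ∈ B, θ b ∈ B := by
    intro b hb
    obtain ⟨p, rfl⟩ := (hBmem b).1 hb
    rw [Derivation.map_aeval, hθs, smul_eq_mul]
    exact B.mul_mem ((hBmem _).2 ⟨_, rfl⟩) (B.neg_mem hsB)
  have hbound : ∃ C : ℤᵐ⁰, ∀ a : A, v (θ (a : F)) ≤ C := by
    obtain ⟨S, hS⟩ := hfin.fg_top
    have hgen : ∃ C : ℤᵐ⁰, ∀ a ∈ S, v (θ (a : F)) ≤ C := by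
      obtain ⟨C, hC⟩ := (S.image fun a : A => v (θ (a : F))).exists_le
      exact ⟨C, fun a ha => hC _ (Finset.mem_image_of_mem _ ha)⟩
    obtain ⟨C, hC⟩ := hgen
    refine ⟨max C 1, fun a => ?_⟩
    have ha : a ∈ Submodule.span B (S : Set A) := by rw [hS]; trivial
    induction ha using Submodule.span_induction with
    | mem a ha => exact (hC a ha).trans (le_max_left _ _)
    | zero => simp
    | add a b _ _ h1 h2 =>
      have : ((a + b : A) : F) = a + b := rfl
      rw [this, map_add]
      exact (v.map_add _ _).trans (max_le h1 h2)
    | smul b a _ h1 =>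
      have : ((b • a : A) : F) = (b : F) * (a : F) := rfl
      rw [this, Derivation.leibniz, smul_eq_mul, smul_eq_mul]
      refine (v.map_add _ _).trans (max_le ?_ ?_)
      · rw [map_mul]; exact mul_le_of_le_one_of_le (hvB _ b.2) h1
      · rw [map_mul]
        exact (mul_le_one' (hvA a) (hvB _ (hθB _ b.2))).trans (le_max_right _ _)
  obtain ⟨C, hC⟩ := hbound
  have hfrac : ∀ u, v u = 1 → ∃ a : A, ∃ b : A, v (a : F) = 1 ∧ v (b : F) = 1 ∧
      u = (a : F) / (b : F) := by
    intro u hu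
    obtain ⟨a, ⟨b, hb⟩, h⟩ := w.exists_primeCompl_mul_eq_of_integer u hu.le
    have hb1 : v (b : F) = 1 := w.valuation_eq_one_iff_notMem.2 hb
    have h' : u * (b : F) = a := h
    refine ⟨a, b, ?_, hb1, ?_⟩
    · rw [← h', map_mul, hu, hb1, one_mul]
    · rw [eq_div_iff, h']
      intro h0; rw [h0] at hb1; simp at hb1
  have key : ∀ f, v (θ f) ≤ v f := by
    refine derivation_valuation_le v θ hK hs0 hvs hθs A.toSubring ?_ ?_ (C := max C C) ?_
    · intro u hu _
      have hvu : v u ≤ 1 := hvA ⟨u, hu⟩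
      obtain ⟨p, hp, hpu⟩ : IsIntegral B u := hu
      choose g hg using fun b : B => (hBmem b).1 b.2
      let c : B → K := fun b => (g b).coeff 0
      have hc : ∀ b : B, v (algebraMap K F (c b) - b) < 1 := by
        intro b
        have h1 : (b : F) = aeval s (divX (g b)) * s + algebraMap K F (c b) := by
          rw [← hg b]
          conv_lhs => rw [← divX_mul_X_add (g b)]
          simp [c]
        have h2 : algebraMap K F (c b) - b = -(aeval s (divX (g b)) * s) := by rw [h1]; ring
        rw [h2, Valuation.map_neg, map_mul, mul_comm]
        exact mul_lt_one_of_lt_of_le hvs (v.aeval_le_one hK hvs.le _)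
      have hg1 : g 1 = 1 := sub_eq_zero.1 (htrans _ (by simp [hg]))
      refine ⟨∑ i ∈ Finset.range (p.natDegree + 1), monomial i (c (p.coeff i)), ?_, ?_⟩
      · intro h0
        have h1 := congrArg (fun q => Polynomial.coeff q p.natDegree) h0
        simp [Polynomial.coeff_monomial, hp.coeff_natDegree, c, hg1] at h1
      · have h1 : aeval u (∑ i ∈ Finset.range (p.natDegree + 1), monomial i (c (p.coeff i))) =
            ∑ i ∈ Finset.range (p.natDegree + 1),
              (algebraMap K F (c (p.coeff i)) - p.coeff i) * u ^ i := by
          rw [eval₂_eq_sum_range] at hpu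
          have h2 : ∑ i ∈ Finset.range (p.natDegree + 1), ((p.coeff i : B) : F) * u ^ i = 0 := hpu
          simp only [sub_mul, Finset.sum_sub_distrib, h2, sub_zero, map_sum, Polynomial.aeval_monomial]
        rw [h1]
        refine v.map_sum_lt one_ne_zero fun i _ => ?_
        rw [map_mul, map_pow]
        exact mul_lt_one_of_lt_of_le (hc _) (pow_le_one' hvu i)
    · intro u hu
      obtain ⟨a, b, h1, h2, h3⟩ := hfrac u hu
      exact ⟨a, a.2, b, b.2, h1, h2, h3⟩
    · intro u hu
      obtain ⟨a, b, h1, h2, rfl⟩ := hfrac u hu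
      have ha0 : (a : F) ≠ 0 := by intro h; simp [h] at h1
      have hb0 : (b : F) ≠ 0 := by intro h; simp [h] at h2
      have h4 : θ ((a : F) / b) = (θ a - (a / b) * θ b) / b := by
        rw [Derivation.leibniz_div]; simp only [smul_eq_mul]; field_simp
      rw [h4, map_div₀, h2, div_one]
      refine (v.map_sub _ _).trans (max_le_max (hC a) ?_)
      rw [map_mul, hu, one_mul]; exact hC b
  refine ⟨v, hK, ?_, fun f => ?_⟩
  · have : v s * v t = 1 := by rw [← map_mul, hs_def, inv_mul_cancel₀ ht0, map_one]
    by_contra h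
    push Not at h
    exact absurd this (mul_lt_one_of_lt_of_le hvs h).ne
  · have := key f
    rwa [hθ_def, Derivation.smul_apply, smul_eq_mul, map_mul, mul_comm] at this

end Growth

open scoped IntermediateField WithZero

section Basics

theorem toF_injective : Function.Injective (toF : SS n → FF n) :=
  IsFractionRing.injective (SS n) (FF n)

@[simp] theorem toF_add (f g : SS n) : toF (f + g) = toF f + toF g := map_add _ _ _
@[simp] theorem toF_sub (f g : SS n) : toF (f - g) = toF f - toF g := map_sub _ _ _
@[simp] theorem toF_neg (f : SS n) : toF (-f) = -toF f := map_neg _ _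
@[simp] theorem toF_mul (f g : SS n) : toF (f * g) = toF f * toF g := map_mul _ _ _
@[simp] theorem toF_pow (f : SS n) (k : ℕ) : toF (f ^ k) = toF f ^ k := map_pow _ _ _
@[simp] theorem toF_zero : toF (0 : SS n) = 0 := map_zero _
@[simp] theorem toF_one : toF (1 : SS n) = 1 := map_one _
@[simp] theorem toF_sum {ι : Type*} (s : Finset ι) (f : ι → SS n) :
    toF (∑ i ∈ s, f i) = ∑ i ∈ s, toF (f i) := map_sum _ _ _
@[simp] theorem toF_prod {ι : Type*} (s : Finset ι) (f : ι → SS n) :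
    toF (∏ i ∈ s, f i) = ∏ i ∈ s, toF (f i) := map_prod _ _ _
theorem toF_C (c : ℝ) : toF (C c : SS n) = algebraMap ℝ (FF n) c :=
  (IsScalarTower.algebraMap_apply ℝ (SS n) (FF n) c).symm
@[simp] theorem toF_smul (c : ℝ) (f : SS n) : toF (c • f) = c • toF f := by
  rw [smul_eq_C_mul, toF_mul, toF_C, Algebra.smul_def]
@[simp] theorem toF_inj {f g : SS n} : toF f = toF g ↔ f = g := toF_injective.eq_iff
@[simp] theorem toF_eq_zero {f : SS n} : toF f = 0 ↔ f = 0 := by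
  rw [← toF_zero, toF_inj]

theorem exists_toF_div (f : FF n) : ∃ a b : SS n, b ≠ 0 ∧ f = toF a / toF b := by
  obtain ⟨a, b, hb, rfl⟩ := IsFractionRing.div_surjective (A := SS n) f
  exact ⟨a, b, nonZeroDivisors.ne_zero hb, rfl⟩

@[simp] theorem derF_toF_C (δ : DerF n) (c : ℝ) : δ (toF (C c)) = 0 := by
  rw [toF_C, Derivation.map_algebraMap]

/-- The chain rule in the coordinates `x_i`. -/
theorem derF_toF (δ : DerF n) (f : SS n) :
    δ (toF f) = ∑ i, toF (pderiv i f) * δ (XF i) := by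
  induction f using MvPolynomial.induction_on with
  | C a => simp
  | add p q hp hq => simp [hp, hq, add_mul, Finset.sum_add_distrib]
  | mul_X p i hp =>
    rw [toF_mul, Derivation.leibniz, hp]
    simp only [Derivation.leibniz, pderiv_X, smul_eq_mul, toF_add, toF_mul, add_mul,
      Finset.sum_add_distrib, Finset.mul_sum]
    congr 1
    · rw [Finset.sum_eq_single i]
      · simp [XF]
      · intro b _ hb; simp [hb.symm]
      · simp
    · refine Finset.sum_congr rfl fun j _ => by ring

theorem derF_div (δ : DerF n) (a b : FF n) (hb : b ≠ 0) :
    δ (a / b) = (δ a * b - a * δ b) / b ^ 2 := by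
  rw [Derivation.leibniz_div]
  simp only [smul_eq_mul]
  field_simp

theorem derF_ext {δ ε : DerF n} (h : ∀ i, δ (XF i) = ε (XF i)) : δ = ε := by
  have h1 : ∀ f : SS n, δ (toF f) = ε (toF f) := fun f => by simp [derF_toF, h]
  ext f
  obtain ⟨a, b, hb, rfl⟩ := exists_toF_div f
  rw [derF_div _ _ _ (by simpa using hb), derF_div _ _ _ (by simpa using hb), h1, h1]

theorem derF_smul_apply (f g : FF n) (δ : DerF n) : (f • δ) g = f * δ g := rfl

theorem derF_sum_apply {ι : Type*} (s : Finset ι) (δ : ι → DerF n) (f : FF n) :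
    (∑ i ∈ s, δ i) f = ∑ i ∈ s, δ i f := by
  classical
  induction s using Finset.induction_on with
  | empty => rfl
  | insert a s ha ih => rw [Finset.sum_insert ha, Finset.sum_insert ha, Derivation.add_apply, ih]

end Basics

section LinearForms

/-- The space `V*` of linear forms. -/
def linForms (n : ℕ) : Submodule ℝ (SS n) := homogeneousSubmodule (Fin n) ℝ 1

theorem mem_linForms {p : SS n} : p ∈ linForms n ↔ p.IsHomogeneous 1 := Iff.rfl

theorem X_mem_linForms (i : Fin n) : (X i : SS n) ∈ linForms n := isHomogeneous_X _ _

theorem linForm_eq {p : SS n} (hp : p ∈ linForms n) :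
    p = ∑ i, p.coeff (Finsupp.single i 1) • X i := by
  ext m
  rw [coeff_sum]
  simp only [coeff_smul, coeff_X, smul_eq_mul, mul_ite, mul_one, mul_zero]
  by_cases hm : m.degree = 1
  · obtain ⟨i, rfl⟩ := (Finsupp.sum_eq_one_iff m).1 hm
    rw [Finset.sum_eq_single i] <;> simp +contextual [Finsupp.single_left_inj]
  · rw [Finset.sum_eq_zero]
    · exact hp.coeff_eq_zero hm
    · rintro i -
      rw [if_neg]
      rintro rfl
      simp at hm

theorem ip1_comm (p q : SS n) : ip1 p q = ip1 q p := by
  simp [ip1, mul_comm]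

theorem ip1_smul_left (c : ℝ) (p r : SS n) : ip1 (c • p) r = c * ip1 p r := by
  simp [ip1, mul_assoc, Finset.mul_sum]

theorem ip1_sub_left (p q r : SS n) : ip1 (p - q) r = ip1 p r - ip1 q r := by
  simp [ip1, sub_mul, Finset.sum_sub_distrib]

theorem ip1_self_pos {p : SS n} (hp : p ∈ linForms n) (h0 : p ≠ 0) : 0 < ip1 p p := by
  refine lt_of_le_of_ne (Finset.sum_nonneg fun i _ => mul_self_nonneg _) fun h => h0 ?_
  have := (Finset.sum_eq_zero_iff_of_nonneg (fun i _ => mul_self_nonneg _)).1 h.symm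
  rw [linForm_eq hp]
  exact Finset.sum_eq_zero fun i hi => by rw [mul_self_eq_zero.1 (this i hi), zero_smul]

theorem ip1_X_left (i : Fin n) (p : SS n) : ip1 (X i) p = p.coeff (Finsupp.single i 1) := by
  rw [ip1, Finset.sum_eq_single i]
  · simp
  · intro j _ hj; simp [coeff_X, Finsupp.single_left_inj, hj.symm]
  · simp

theorem derF_linForm (δ : DerF n) {p : SS n} (hp : p ∈ linForms n) :
    δ (toF p) = ∑ i, p.coeff (Finsupp.single i 1) • δ (XF i) := by
  conv_lhs => rw [linForm_eq hp]
  simp [XF]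

theorem linForm_irreducible {p : SS n} (hp : p ∈ linForms n) (h0 : p ≠ 0) : Irreducible p := by
  have hp' := mem_linForms.1 hp
  refine irreducible_of_totalDegree_eq_one (hp'.totalDegree h0) ?_
  intro x hx
  obtain ⟨m, hm⟩ := MvPolynomial.ne_zero_iff.1 h0
  exact isUnit_of_dvd_unit (hx m) hm.isUnit

theorem linForm_dvd {p q : SS n} (hp : p ∈ linForms n) (hq : q ∈ linForms n) (h : p ∣ q) :
    ∃ c : ℝ, q = c • p := by
  rcases eq_or_ne q 0 with rfl | h0
  · exact ⟨0, by simp⟩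
  obtain ⟨r, rfl⟩ := h
  have hp0 : p ≠ 0 := by rintro rfl; simp at h0
  have hr0 : r ≠ 0 := by rintro rfl; simp at h0
  have h1 := totalDegree_mul_of_isDomain hp0 hr0
  rw [(mem_linForms.1 hp).totalDegree hp0, (mem_linForms.1 hq).totalDegree h0] at h1
  have h2 : r.totalDegree = 0 := by omega
  rw [totalDegree_eq_zero_iff_eq_C] at h2
  refine ⟨coeff 0 r, ?_⟩
  conv_lhs => rw [h2]
  rw [smul_eq_C_mul, mul_comm]

/-- A subspace containing every linear form outside finitely many proper subspaces is everything. -/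
theorem linForms_le_of_generic {ι : Type*} [Finite ι] (U : ι → Submodule ℝ (SS n))
    (hU : ∀ i, ¬ linForms n ≤ U i) (G : Submodule ℝ (SS n))
    (hG : ∀ a ∈ linForms n, (∀ i, a ∉ U i) → a ∈ G) : linForms n ≤ G := by
  by_contra hG'
  let U' : Option ι → Submodule ℝ (linForms n) := fun o =>
    (o.elim G U).comap (linForms n).subtype
  have htop : ∀ o, U' o ≠ ⊤ := by
    intro o ho
    rw [Submodule.comap_subtype_eq_top] at ho
    cases o with
    | none => exact hG' ho
    | some i => exact hU i ho
  cases nonempty_fintype ι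
  have h := Subspace.biUnion_ne_univ_of_top_notMem (k := ℝ) (E := linForms n)
    (s := Finset.univ.image U') (by simpa using htop)
  apply h
  rw [Set.eq_univ_iff_forall]
  rintro ⟨a, ha⟩
  simp only [Finset.mem_image, Finset.mem_univ, true_and, Set.iUnion_exists, Set.mem_iUnion]
  by_cases hx : ∃ i, a ∈ U i
  · obtain ⟨i, hi⟩ := hx
    exact ⟨_, some i, rfl, hi⟩
  · push Not at hx
    exact ⟨_, none, rfl, hG a ha hx⟩

end LinearForms

section LocalRing

/-- The localization of `S` at the prime `π`, as a subring of `F`. -/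
def locRing (π : SS n) (hπ : Prime π) : Subring (FF n) where
  carrier := {f | ∃ s t : SS n, ¬ π ∣ t ∧ f * toF t = toF s}
  mul_mem' := by
    rintro f g ⟨s, t, ht, h⟩ ⟨s', t', ht', h'⟩
    refine ⟨s * s', t * t', hπ.not_dvd_mul ht ht', ?_⟩
    rw [toF_mul, toF_mul, ← h, ← h']; ring
  one_mem' := ⟨1, 1, fun h => hπ.not_isUnit (isUnit_of_dvd_one h), by simp⟩
  add_mem' := by
    rintro f g ⟨s, t, ht, h⟩ ⟨s', t', ht', h'⟩
    refine ⟨s * t' + s' * t, t * t', hπ.not_dvd_mul ht ht', ?_⟩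
    simp only [toF_mul, toF_add, ← h, ← h']; ring
  zero_mem' := ⟨0, 1, fun h => hπ.not_isUnit (isUnit_of_dvd_one h), by simp⟩
  neg_mem' := by
    rintro f ⟨s, t, ht, h⟩
    exact ⟨-s, t, ht, by simp [← h]⟩

theorem toF_mem_locRing {π : SS n} (hπ : Prime π) (f : SS n) : toF f ∈ locRing π hπ :=
  ⟨f, 1, fun h => hπ.not_isUnit (isUnit_of_dvd_one h), by simp⟩

theorem mem_locRing_of_mul {π : SS n} (hπ : Prime π) {t : SS n} (ht : ¬ π ∣ t) {f : FF n}
    (h : toF t * f ∈ locRing π hπ) : f ∈ locRing π hπ := by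
  obtain ⟨s, t', ht', h'⟩ := h
  exact ⟨s, t * t', hπ.not_dvd_mul ht ht', by rw [← h', toF_mul]; ring⟩

theorem inv_toF_mem_locRing {π : SS n} (hπ : Prime π) {t : SS n} (ht : ¬ π ∣ t) :
    (toF t)⁻¹ ∈ locRing π hπ := by
  refine mem_locRing_of_mul hπ ht ?_
  rw [mul_inv_cancel₀]
  · exact Subring.one_mem _
  · rw [Ne, toF_eq_zero]; rintro rfl; exact ht (dvd_zero _)

theorem smul_mem_locRing {π : SS n} (hπ : Prime π) (c : ℝ) {f : FF n} (h : f ∈ locRing π hπ) :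
    c • f ∈ locRing π hπ := by
  rw [Algebra.smul_def, ← toF_C]
  exact Subring.mul_mem _ (toF_mem_locRing hπ _) h

theorem mem_locRing_of_smul {π : SS n} (hπ : Prime π) {c : ℝ} (hc : c ≠ 0) {f : FF n}
    (h : c • f ∈ locRing π hπ) : f ∈ locRing π hπ := by
  have := smul_mem_locRing hπ c⁻¹ h
  rwa [smul_smul, inv_mul_cancel₀ hc, one_smul] at this

/-- `S` is the intersection of its localizations at principal primes. -/
theorem exists_toF_of_forall_locRing {f : FF n} (h : ∀ π (hπ : Prime π), f ∈ locRing π hπ) :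
    ∃ s : SS n, f = toF s := by
  obtain ⟨a, b, hab, rfl⟩ := IsFractionRing.exists_reduced_fraction (A := SS n) f
  have hb0 : (b : SS n) ≠ 0 := nonZeroDivisors.ne_zero b.2
  by_cases hb : IsUnit (b : SS n)
  · obtain ⟨c, hc⟩ := hb.exists_right_inv
    refine ⟨a * c, ?_⟩
    rw [IsLocalization.mk'_eq_iff_eq_mul]
    change toF a = toF (a * c) * toF (b : SS n)
    rw [← toF_mul, toF_inj, mul_assoc, mul_comm c, hc, mul_one]
  · obtain ⟨π, hπ, hπb⟩ := WfDvdMonoid.exists_irreducible_factor hb hb0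
    exfalso
    obtain ⟨s, t, ht, hst⟩ := h π hπ.prime
    have h1 : a * t = s * b := by
      rw [IsFractionRing.mk'_eq_div] at hst
      change toF a / toF (b : SS n) * toF t = toF s at hst
      have hb' : toF (b : SS n) ≠ 0 := by simp
      rw [← toF_inj, toF_mul, toF_mul, ← hst]; field_simp
    have h2 : π ∣ a * t := h1 ▸ Dvd.dvd.mul_left hπb s
    rcases hπ.prime.dvd_or_dvd h2 with h3 | h3
    · exact hπ.not_isUnit (hab h3 hπb)
    · exact ht h3

end LocalRing

namespace CoxSetup

variable (C : CoxSetup n hn hyp W)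

section Action

theorem actS_mem_linForms (w : W) {p : SS n} (hp : p ∈ linForms n) : C.actS w p ∈ linForms n :=
  C.actS_lin w p hp

theorem actS_mul_apply (w w' : W) (f : SS n) : C.actS (w * w') f = C.actS w (C.actS w' f) := by
  rw [map_mul]; rfl

theorem actS_one_apply (f : SS n) : C.actS 1 f = f := by rw [map_one]; rfl

theorem eq_one_of_forall_linForms {w : W} (h : ∀ p ∈ linForms n, C.actS w p = p) : w = 1 := by
  refine C.actS_faithful w fun f => ?_
  have : (C.actS w).toAlgHom = AlgHom.id ℝ (SS n) :=
    MvPolynomial.algHom_ext fun i => h _ (X_mem_linForms i)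
  exact DFunLike.congr_fun this f

theorem α_mem (H : hyp) : C.α H ∈ linForms n := C.α_hom H

theorem α_prime (H : hyp) : Prime (C.α H) := (linForm_irreducible (C.α_mem H) (C.α_ne H)).prime

theorem eq_of_α_dvd {H H' : hyp} (h : C.α H ∣ C.α H') : H = H' := by
  obtain ⟨c, hc⟩ := linForm_dvd (C.α_mem H) (C.α_mem H') h
  refine (C.α_red H' H ⟨c, ?_, hc⟩).symm
  rintro rfl
  exact C.α_ne H' (by simpa using hc)

theorem actF_apply_XF (w : W) (i : Fin n) : C.actF w (XF i) = toF (C.actS w (X i)) :=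
  C.actF_compat w _

theorem reflW_sub {H : hyp} {a : SS n} (ha : a ∈ linForms n) :
    ∃ c : ℝ, a - C.actS (C.reflW H) a = c • C.α H := by
  have hpos := ip1_self_pos (C.α_mem H) (C.α_ne H)
  set r := ip1 a (C.α H) / ip1 (C.α H) (C.α H) with hr
  have h1 : a - r • C.α H ∈ linForms n :=
    Submodule.sub_mem _ ha (Submodule.smul_mem _ _ (C.α_mem H))
  have h2 := C.reflW_fix H _ h1 (by rw [ip1_sub_left, ip1_smul_left, hr]; field_simp; ring)
  rw [map_sub, map_smul, C.reflW_α] at h2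
  refine ⟨2 * r, ?_⟩
  have h3 : C.actS (C.reflW H) a = a - r • C.α H + r • -C.α H := by rw [← h2]; abel
  rw [h3, two_mul, add_smul, smul_neg]; abel

theorem reflW_mul_self (H : hyp) : C.reflW H * C.reflW H = 1 := by
  refine C.eq_one_of_forall_linForms fun p hp => ?_
  obtain ⟨c, hc⟩ := C.reflW_sub (H := H) hp
  have h1 : C.actS (C.reflW H) p = p - c • C.α H := by rw [← hc]; abel
  rw [actS_mul_apply, h1, map_sub, map_smul, C.reflW_α, h1, smul_neg]; abel

/-- An element acting trivially modulo a prime is the reflection in a hyperplane. -/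
theorem eq_reflW_of_forall_dvd {π : SS n} (hπ : Prime π) {w : W} (hw : w ≠ 1)
    (h : ∀ a ∈ linForms n, π ∣ a - C.actS w a) :
    ∃ H, w = C.reflW H ∧ Associated π (C.α H) := by
  obtain ⟨a₀, ha₀, hne⟩ : ∃ a ∈ linForms n, C.actS w a ≠ a := by
    by_contra! h'
    exact hw (C.eq_one_of_forall_linForms h')
  set p := a₀ - C.actS w a₀ with hp_def
  have hp : p ∈ linForms n := Submodule.sub_mem _ ha₀ (C.actS_mem_linForms w ha₀)
  have hp0 : p ≠ 0 := fun h0 => hne (sub_eq_zero.1 h0).symm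
  have hassoc : Associated π p :=
    hπ.irreducible.associated_of_dvd (linForm_irreducible hp hp0) (h a₀ ha₀)
  have hpos := ip1_self_pos hp hp0
  have key : ∀ a ∈ linForms n, ∃ c : ℝ, C.actS w a = a - c • p ∧
      c * (c * ip1 p p - 2 * ip1 a p) = 0 := by
    intro a ha
    obtain ⟨c, hc⟩ := linForm_dvd hp (Submodule.sub_mem _ ha (C.actS_mem_linForms w ha))
      (hassoc.symm.dvd.trans (h a ha))
    have h1 : C.actS w a = a - c • p := by rw [← hc]; abel
    refine ⟨c, h1, ?_⟩
    have h2 := C.actS_orth w a a ha ha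
    rw [h1, ip1_sub_left, ip1_comm a, ip1_comm (c • p), ip1_sub_left, ip1_sub_left,
      ip1_smul_left, ip1_smul_left, ip1_comm a (c • p), ip1_smul_left, ip1_comm p a,
      ip1_comm p (c • p), ip1_smul_left] at h2
    linear_combination h2
  have hfix : ∀ a ∈ linForms n, ip1 p a = 0 → C.actS w a = a := by
    intro a ha h0
    obtain ⟨c, h1, h2⟩ := key a ha
    rw [ip1_comm a, h0, mul_zero, sub_zero, ← mul_assoc] at h2
    have : c = 0 := by
      rcases mul_eq_zero.1 h2 with h3 | h3
      · exact mul_self_eq_zero.1 h3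
      · exact absurd h3 hpos.ne'
    rw [h1, this, zero_smul, sub_zero]
  have hdecomp : ∀ a ∈ linForms n, ∃ (r : ℝ), ∃ b ∈ linForms n, ip1 p b = 0 ∧ a = r • p + b := by
    intro a ha
    refine ⟨ip1 a p / ip1 p p, a - (ip1 a p / ip1 p p) • p,
      Submodule.sub_mem _ ha (Submodule.smul_mem _ _ hp), ?_, by abel⟩
    rw [ip1_comm, ip1_sub_left, ip1_smul_left]; field_simp; ring
  have hwp : C.actS w p = -p := by
    obtain ⟨c, h1, h2⟩ := key p hp
    have h3 : c * (c - 2) = 0 := by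
      have : c * (c - 2) * ip1 p p = 0 := by linear_combination h2
      exact (mul_eq_zero.1 this).resolve_right hpos.ne'
    rcases mul_eq_zero.1 h3 with h4 | h4
    · exfalso
      refine hw (C.eq_one_of_forall_linForms fun a ha => ?_)
      obtain ⟨r, b, hb, hb0, rfl⟩ := hdecomp a ha
      rw [map_add, map_smul, hfix b hb hb0, h1, h4, zero_smul, sub_zero]
    · have : c = 2 := by linarith
      rw [h1, this, two_smul]; abel
  obtain ⟨H, c, hc, hpc⟩ := C.hyp_all w p hp hp0 hwp hfix
  refine ⟨H, ?_, hassoc.trans ?_⟩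
  · have hsp : C.actS (C.reflW H) p = -p := by rw [hpc, map_smul, C.reflW_α, smul_neg]
    have hagree : ∀ a ∈ linForms n, C.actS w a = C.actS (C.reflW H) a := by
      intro a ha
      obtain ⟨r, b, hb, hb0, rfl⟩ := hdecomp a ha
      have : ip1 b (C.α H) = 0 := by
        rw [hpc, ip1_smul_left] at hb0
        rw [ip1_comm]; exact (mul_eq_zero.1 hb0).resolve_left hc
      rw [map_add, map_add, map_smul, map_smul, hwp, hsp, hfix b hb hb0, C.reflW_fix H b hb this]
    have h1 : w * C.reflW H = 1 := by
      refine C.eq_one_of_forall_linForms fun a ha => ?_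
      rw [actS_mul_apply, hagree _ (C.actS_mem_linForms _ ha), ← actS_mul_apply, reflW_mul_self,
        actS_one_apply]
    rw [eq_inv_of_mul_eq_one_left h1, inv_eq_of_mul_eq_one_left (C.reflW_mul_self H)]
  · rw [hpc, smul_eq_C_mul]
    exact (associated_unit_mul_left _ _ ((isUnit_iff_ne_zero.2 hc).map MvPolynomial.C))

end Action

section OrbitPolynomial

open Classical in
/-- The value at `a` of the derivative of the orbit polynomial of `a`. -/
def derivProd (a : SS n) : SS n := ∏ w ∈ Finset.univ.erase (1 : W), (a - C.actS w a)

/-- The orbit polynomial `∏_w (T - w a)`. -/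
def orbitPoly (a : SS n) : Polynomial (SS n) :=
  ∏ w : W, (Polynomial.X - Polynomial.C (C.actS w a))

theorem orbitPoly_monic (a : SS n) : (C.orbitPoly a).Monic :=
  Polynomial.monic_prod_of_monic _ _ fun _ _ => Polynomial.monic_X_sub_C _

theorem orbitPoly_natDegree (a : SS n) : (C.orbitPoly a).natDegree = Fintype.card W := by
  rw [orbitPoly, Polynomial.natDegree_prod_of_monic _ _ fun _ _ => Polynomial.monic_X_sub_C _]
  simp

theorem orbitPoly_eq (a : SS n) : C.orbitPoly a = (Polynomial.X - Polynomial.C a) *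
    (open Classical in ∏ w ∈ Finset.univ.erase (1 : W),
      (Polynomial.X - Polynomial.C (C.actS w a))) := by
  classical
  rw [orbitPoly, ← Finset.mul_prod_erase _ _ (Finset.mem_univ (1 : W)), actS_one_apply]

theorem orbitPoly_eval (a : SS n) : (C.orbitPoly a).eval a = 0 := by
  rw [orbitPoly_eq]; simp

theorem orbitPoly_derivative_eval (a : SS n) :
    (Polynomial.derivative (C.orbitPoly a)).eval a = C.derivProd a := by
  rw [orbitPoly_eq, Polynomial.derivative_mul]
  simp [Polynomial.eval_prod, derivProd]

theorem orbitPoly_coeff_mem (a : SS n) (i : ℕ) : (C.orbitPoly a).coeff i ∈ Rinv C := by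
  intro w
  have h : (C.orbitPoly a).map (C.actS w : SS n →+* SS n) = C.orbitPoly a := by
    rw [orbitPoly, Polynomial.map_prod]
    refine Fintype.prod_equiv (Equiv.mulLeft w) _ _ fun w' => ?_
    simp
  conv_rhs => rw [← h]
  rw [Polynomial.coeff_map]; rfl

theorem der_eval (δ : DerF n) (p : Polynomial (SS n)) (a : SS n) :
    δ (toF (p.eval a)) = ∑ i ∈ Finset.range (p.natDegree + 1), δ (toF (p.coeff i)) * toF a ^ i +
      toF ((Polynomial.derivative p).eval a) * δ (toF a) := by
  rw [Polynomial.derivative_eval, Polynomial.eval_eq_sum_range,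
    Polynomial.sum_over_range _ (by simp), toF_sum, map_sum, toF_sum, Finset.sum_mul,
    ← Finset.sum_add_distrib]
  refine Finset.sum_congr rfl fun i _ => ?_
  rw [toF_mul, Derivation.leibniz, toF_pow, Derivation.leibniz_pow]
  simp only [smul_eq_mul, nsmul_eq_mul, toF_mul, toF_pow]
  have : toF ((i : SS n)) = (i : FF n) := map_natCast _ _
  rw [this]; ring

theorem adjoin_le_Rinv {r : SS n} (hr : r ∈ Algebra.adjoin ℝ (Set.range C.P)) : r ∈ Rinv C := by
  intro w
  have : Algebra.adjoin ℝ (Set.range C.P) ≤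
      AlgHom.equalizer (C.actS w).toAlgHom (AlgHom.id ℝ (SS n)) := by
    refine Algebra.adjoin_le ?_
    rintro _ ⟨j, rfl⟩
    exact C.P_inv w j
  exact this hr

theorem der_mem_of_mem_Rinv (O : Subring (FF n)) (hO : ∀ f, toF f ∈ O) {δ : DerF n}
    (h : ∀ j, δ (toF (C.P j)) ∈ O) {r : SS n} (hr : r ∈ Rinv C) : δ (toF r) ∈ O := by
  have := C.P_gen r hr
  induction this using Algebra.adjoin_induction with
  | mem x hx => obtain ⟨j, rfl⟩ := hx; exact h j
  | algebraMap c =>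
    rw [MvPolynomial.algebraMap_eq, derF_toF_C]; exact O.zero_mem
  | add x y hx hy ihx ihy =>
    rw [toF_add, map_add]
    exact O.add_mem (ihx (C.adjoin_le_Rinv hx)) (ihy (C.adjoin_le_Rinv hy))
  | mul x y hx hy ihx ihy =>
    rw [toF_mul, Derivation.leibniz]
    exact O.add_mem (O.mul_mem (hO _) (ihy (C.adjoin_le_Rinv hy)))
      (O.mul_mem (hO _) (ihx (C.adjoin_le_Rinv hx)))

theorem derivProd_mul_mem (O : Subring (FF n)) (hO : ∀ f, toF f ∈ O) {δ : DerF n}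
    (h : ∀ j, δ (toF (C.P j)) ∈ O) (a : SS n) : toF (C.derivProd a) * δ (toF a) ∈ O := by
  have h1 := der_eval δ (C.orbitPoly a) a
  rw [orbitPoly_eval, toF_zero, map_zero, orbitPoly_derivative_eval] at h1
  rw [← neg_eq_of_add_eq_zero_right h1.symm]
  refine O.neg_mem (O.sum_mem fun i _ => O.mul_mem ?_ (O.pow_mem (hO _) _))
  exact C.der_mem_of_mem_Rinv O hO h (C.orbitPoly_coeff_mem a i)

end OrbitPolynomial
end CoxSetup

namespace CoxSetup

variable (C : CoxSetup n hn hyp W)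

section Generic

theorem der_eq_zero_of_Rinv {δ : DerF n} (h : ∀ j, δ (toF (C.P j)) = 0) {r : SS n}
    (hr : r ∈ Rinv C) : δ (toF r) = 0 := by
  have := C.P_gen r hr
  clear hr
  induction this using Algebra.adjoin_induction with
  | mem x hx => obtain ⟨j, rfl⟩ := hx; exact h j
  | algebraMap c => rw [MvPolynomial.algebraMap_eq, derF_toF_C]
  | add x y _ _ ihx ihy => rw [toF_add, map_add, ihx, ihy, add_zero]
  | mul x y _ _ ihx ihy => rw [toF_mul, Derivation.leibniz, ihx, ihy, smul_zero, smul_zero, add_zero]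

theorem linForms_not_le_fixed {w : W} (hw : w ≠ 1) :
    ¬ linForms n ≤ LinearMap.ker (LinearMap.id - (C.actS w).toLinearMap) := fun h =>
  hw (C.eq_one_of_forall_linForms fun p hp => by
    have := h hp
    rw [LinearMap.mem_ker] at this
    exact (sub_eq_zero.1 this).symm)

theorem derF_eq_zero_of_linForms {δ : DerF n} (h : ∀ a ∈ linForms n, δ (toF a) = 0) : δ = 0 :=
  derF_ext fun i => h _ (X_mem_linForms i)

/-- A derivation of `F` is determined by its values on the basic invariants. -/
theorem der_eq_zero {δ : DerF n} (h : ∀ j, δ (toF (C.P j)) = 0) : δ = 0 := by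
  classical
  let G : Submodule ℝ (SS n) :=
    LinearMap.ker (δ.toLinearMap ∘ₗ (IsScalarTower.toAlgHom ℝ (SS n) (FF n)).toLinearMap)
  have hG : ∀ a, a ∈ G ↔ δ (toF a) = 0 := fun a => LinearMap.mem_ker
  refine derF_eq_zero_of_linForms fun a ha => (hG a).1 ?_
  refine linForms_le_of_generic (ι := {w : W // w ≠ 1})
    (fun w => LinearMap.ker (LinearMap.id - (C.actS w).toLinearMap))
    (fun w => C.linForms_not_le_fixed w.2) G (fun a _ hgen => (hG a).2 ?_) ha
  have h1 := der_eval δ (C.orbitPoly a) a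
  rw [orbitPoly_eval, toF_zero, map_zero, orbitPoly_derivative_eval, Finset.sum_eq_zero, zero_add]
    at h1
  · refine (mul_eq_zero.1 h1.symm).resolve_left ?_
    rw [toF_eq_zero, derivProd, Finset.prod_eq_zero_iff]
    rintro ⟨w, hw, hw0⟩
    exact hgen ⟨w, by simpa using hw⟩ (LinearMap.mem_ker.2 hw0)
  · intro i _
    rw [C.der_eq_zero_of_Rinv h (C.orbitPoly_coeff_mem a i), zero_mul]

theorem der_ext {δ ε : DerF n} (h : ∀ j, δ (toF (C.P j)) = ε (toF (C.P j))) : δ = ε :=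
  sub_eq_zero.1 (C.der_eq_zero fun j => by rw [Derivation.sub_apply, h, sub_self])

theorem der_eq_sum (δ : DerF n) : δ = ∑ j, δ (toF (C.P j)) • C.dP j := by
  refine C.der_ext fun k => ?_
  rw [derF_sum_apply, Finset.sum_eq_single k]
  · rw [derF_smul_apply, C.dP_eq, if_pos rfl, mul_one]
  · intro j _ hj; rw [derF_smul_apply, C.dP_eq, if_neg hj, mul_zero]
  · simp

theorem dP_commute (i j : Fin n) (f : FF n) : C.dP i (C.dP j f) = C.dP j (C.dP i f) := by
  have : ⁅C.dP i, C.dP j⁆ = 0 := C.der_eq_zero fun k => by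
    rw [Derivation.commutator_apply, C.dP_eq, C.dP_eq]
    split_ifs <;> simp
  have h1 := DFunLike.congr_fun this f
  rw [Derivation.commutator_apply] at h1
  exact sub_eq_zero.1 h1

theorem conjDer_apply (w : W) (δ : DerF n) (f : FF n) :
    conjDer (C.actF w) δ (C.actF w f) = C.actF w (δ f) := by
  change C.actF w (δ ((C.actF w).symm (C.actF w f))) = _
  rw [AlgEquiv.symm_apply_apply]

/-- `θ` is `W`-invariant as an operator on `F`. -/
theorem inv_of_P {δ : DerF n} (h : ∀ w j, C.actF w (δ (toF (C.P j))) = δ (toF (C.P j)))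
    (w : W) (f : FF n) : C.actF w (δ f) = δ (C.actF w f) := by
  have : conjDer (C.actF w) δ = δ := C.der_ext fun j => by
    have h1 := C.conjDer_apply w δ (toF (C.P j))
    rw [C.actF_compat, C.P_inv] at h1
    rw [h1, h]
  rw [← conjDer_apply, this]

end Generic

section Etale

variable {π : SS n} (hπ : Prime π)

/-- Linear forms `a` with `π ∣ a - w a`. -/
def dvdSub (π : SS n) (w : W) : Submodule ℝ (SS n) where
  carrier := {a | π ∣ a - C.actS w a}
  add_mem' := by
    rintro a b ha hb
    simp only [Set.mem_ofPred_eq, map_add] at *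
    have : a + b - (C.actS w a + C.actS w b) = (a - C.actS w a) + (b - C.actS w b) := by ring
    rw [this]; exact dvd_add ha hb
  zero_mem' := by simp
  smul_mem' := by
    rintro c a ha
    simp only [Set.mem_ofPred_eq, map_smul] at *
    rw [← smul_sub, smul_eq_C_mul]
    exact Dvd.dvd.mul_left ha _

/-- The linear forms on which `δ` takes values whose multiple by `g` is regular at `π`. -/
def regForms (δ : DerF n) (g : FF n) : Submodule ℝ (SS n) where
  carrier := {a | g * δ (toF a) ∈ locRing π hπ}
  add_mem' := by
    rintro a b ha hb
    simp only [Set.mem_ofPred_eq, toF_add, map_add, mul_add] at *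
    exact Subring.add_mem _ ha hb
  zero_mem' := by simp
  smul_mem' := by
    rintro c a ha
    simp only [Set.mem_ofPred_eq, toF_smul, Derivation.map_smul, mul_smul_comm] at *
    exact smul_mem_locRing hπ _ ha

theorem regular_of_not_associated (hna : ∀ H, ¬ Associated π (C.α H)) {δ : DerF n}
    (h : ∀ j, δ (toF (C.P j)) ∈ locRing π hπ) {a : SS n} (ha : a ∈ linForms n) :
    δ (toF a) ∈ locRing π hπ := by
  classical
  have hle : linForms n ≤ regForms hπ δ 1 := by
    refine linForms_le_of_generic (ι := {w : W // w ≠ 1}) (fun w => C.dvdSub π w) ?_ _ ?_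
    · rintro ⟨w, hw⟩ hle
      obtain ⟨H, -, hH⟩ := C.eq_reflW_of_forall_dvd hπ hw hle
      exact hna H hH
    · intro a _ hgen
      change 1 * δ (toF a) ∈ locRing π hπ
      rw [one_mul]
      refine mem_locRing_of_mul hπ ?_ (C.derivProd_mul_mem _ (toF_mem_locRing hπ) h a)
      rw [derivProd, hπ.dvd_finsetProd_iff]
      rintro ⟨w, hw, hw0⟩
      exact hgen ⟨w, by simpa using hw⟩ hw0
  have := hle ha
  change 1 * δ (toF a) ∈ locRing π hπ at this
  rwa [one_mul] at this

theorem simple_pole (H : hyp) {δ : DerF n}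
    (h : ∀ j, δ (toF (C.P j)) ∈ locRing (C.α H) (C.α_prime H)) {a : SS n} (ha : a ∈ linForms n) :
    toF (C.α H) * δ (toF a) ∈ locRing (C.α H) (C.α_prime H) := by
  classical
  have hrefl : C.reflW H ≠ 1 := by
    intro h1
    have h2 := C.reflW_α H
    rw [h1, actS_one_apply] at h2
    exact C.α_ne H (self_eq_neg.1 h2)
  refine linForms_le_of_generic (ι := {w : W // w ≠ 1})
    (fun w => if (w : W) = C.reflW H then
      LinearMap.ker (LinearMap.id - (C.actS w).toLinearMap) else C.dvdSub (C.α H) w) ?_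
      (regForms (C.α_prime H) δ (toF (C.α H))) ?_ ha
  · rintro ⟨w, hw⟩ hle
    dsimp only at hle
    split_ifs at hle with hwH
    · exact C.linForms_not_le_fixed hw hle
    · obtain ⟨H', hw', hH'⟩ := C.eq_reflW_of_forall_dvd (C.α_prime H) hw hle
      rw [← C.eq_of_α_dvd hH'.dvd] at hw'
      exact hwH hw'
  · intro a ha hgen
    change toF (C.α H) * δ (toF a) ∈ locRing (C.α H) (C.α_prime H)
    obtain ⟨c, hc⟩ := C.reflW_sub (H := H) ha
    have hc0 : c ≠ 0 := by
      rintro rfl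
      refine hgen ⟨_, hrefl⟩ ?_
      rw [if_pos rfl, LinearMap.mem_ker]
      simpa using hc
    have hmem : C.reflW H ∈ Finset.univ.erase (1 : W) := by simp [hrefl]
    have h1 := C.derivProd_mul_mem _ (toF_mem_locRing (C.α_prime H)) h a
    rw [derivProd, ← Finset.mul_prod_erase _ _ hmem, hc] at h1
    refine mem_locRing_of_smul _ hc0 (mem_locRing_of_mul (C.α_prime H)
      (t := ∏ w ∈ (Finset.univ.erase (1 : W)).erase (C.reflW H), (a - C.actS w a)) ?_ ?_)
    · rw [(C.α_prime H).dvd_finsetProd_iff]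
      rintro ⟨w, hw, hw0⟩
      simp only [Finset.mem_erase, Finset.mem_univ, and_true] at hw
      refine hgen ⟨w, hw.2⟩ ?_
      rw [if_neg hw.1]
      exact hw0
    · convert h1 using 1
      rw [toF_mul, toF_smul]
      simp only [Algebra.smul_def]
      ring

end Etale
end CoxSetup

section LocUnit

variable {π : SS n} {hπ : Prime π}

/-- `f` is a unit of the localization of `S` at `π`. -/
def IsLocUnit (π : SS n) (hπ : Prime π) (f : FF n) : Prop :=
  f ≠ 0 ∧ f ∈ locRing π hπ ∧ f⁻¹ ∈ locRing π hπ

theorem isLocUnit_toF {s : SS n} (hs : ¬ π ∣ s) : IsLocUnit π hπ (toF s) :=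
  ⟨by rw [Ne, toF_eq_zero]; rintro rfl; exact hs (dvd_zero _), toF_mem_locRing hπ s,
    inv_toF_mem_locRing hπ hs⟩

theorem IsLocUnit.mul {f g : FF n} (hf : IsLocUnit π hπ f) (hg : IsLocUnit π hπ g) :
    IsLocUnit π hπ (f * g) :=
  ⟨mul_ne_zero hf.1 hg.1, Subring.mul_mem _ hf.2.1 hg.2.1, by
    rw [mul_inv]; exact Subring.mul_mem _ hf.2.2 hg.2.2⟩

theorem IsLocUnit.inv {f : FF n} (hf : IsLocUnit π hπ f) : IsLocUnit π hπ f⁻¹ :=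
  ⟨inv_ne_zero hf.1, hf.2.2, by rw [inv_inv]; exact hf.2.1⟩

theorem toF_prime_ne_zero (hπ : Prime π) : toF π ≠ 0 := by
  rw [Ne, toF_eq_zero]; exact hπ.ne_zero

theorem inv_prime_notMem_locRing : (toF π)⁻¹ ∉ locRing π hπ := by
  rintro ⟨s, t, ht, h⟩
  rw [inv_mul_eq_div, div_eq_iff (toF_prime_ne_zero hπ), ← toF_mul, toF_inj] at h
  exact ht ⟨s, by rw [h, mul_comm]⟩

theorem isLocUnit_or {f : FF n} (hf : f ∈ locRing π hπ) :
    IsLocUnit π hπ f ∨ (toF π)⁻¹ * f ∈ locRing π hπ := by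
  obtain ⟨s, t, ht, h⟩ := hf
  have ht0 : toF t ≠ 0 := (isLocUnit_toF (hπ := hπ) ht).1
  by_cases hs : π ∣ s
  · right
    obtain ⟨s', rfl⟩ := hs
    refine ⟨s', t, ht, ?_⟩
    rw [mul_assoc, h, toF_mul, inv_mul_cancel_left₀ (toF_prime_ne_zero hπ)]
  · left
    rw [eq_div_of_mul_eq ht0 h, div_eq_mul_inv]
    exact (isLocUnit_toF hs).mul (isLocUnit_toF ht).inv

theorem IsLocUnit.inv_mul_notMem {f : FF n} (hf : IsLocUnit π hπ f) :
    (toF π)⁻¹ * f ∉ locRing π hπ := fun h => by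
  have := Subring.mul_mem _ h hf.2.2
  rw [mul_assoc, mul_inv_cancel₀ hf.1, mul_one] at this
  exact inv_prime_notMem_locRing this

theorem IsLocUnit.add_mul {f g : FF n} (hf : IsLocUnit π hπ f) (hg : g ∈ locRing π hπ) :
    IsLocUnit π hπ (f + toF π * g) := by
  refine (isLocUnit_or (Subring.add_mem _ hf.2.1 (Subring.mul_mem _ (toF_mem_locRing hπ π) hg)))
    |>.resolve_right fun h => hf.inv_mul_notMem ?_
  rw [mul_add, inv_mul_cancel_left₀ (toF_prime_ne_zero hπ)] at h
  simpa using Subring.sub_mem _ h hg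

/-- Every nonzero element of `F` is a power of `π` times a local unit. -/
theorem exists_zpow_mul_isLocUnit (hπ : Prime π) {f : FF n} (hf : f ≠ 0) :
    ∃ (k : ℤ) (g : FF n), IsLocUnit π hπ g ∧ f = toF π ^ k * g := by
  have key : ∀ a : SS n, a ≠ 0 → ∃ (k : ℕ) (g : SS n), ¬ π ∣ g ∧ a = π ^ k * g := fun a ha => by
    obtain ⟨g, h1, h2⟩ := (FiniteMultiplicity.of_prime_left hπ ha).exists_eq_pow_mul_and_not_dvd
    exact ⟨_, g, h2, h1⟩
  obtain ⟨a, b, hb, rfl⟩ := exists_toF_div f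
  have ha : a ≠ 0 := by rintro rfl; simp at hf
  obtain ⟨k, g, hg, rfl⟩ := key a ha
  obtain ⟨k', g', hg', rfl⟩ := key b hb
  refine ⟨k - k', toF g * (toF g')⁻¹, (isLocUnit_toF hg).mul (isLocUnit_toF hg').inv, ?_⟩
  have := toF_prime_ne_zero hπ
  have h2 := (isLocUnit_toF (hπ := hπ) hg').1
  rw [zpow_sub₀ this, toF_mul, toF_mul, toF_pow, toF_pow, zpow_natCast, zpow_natCast]
  field_simp

theorem eq_of_zpow_mul_eq {k k' : ℤ} {g g' : FF n} (hg : IsLocUnit π hπ g)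
    (hg' : IsLocUnit π hπ g') (h : toF π ^ k * g = toF π ^ k' * g') : k = k' := by
  have key : ∀ {k k' : ℤ} {g g' : FF n}, IsLocUnit π hπ g → IsLocUnit π hπ g' →
      toF π ^ k * g = toF π ^ k' * g' → k ≤ k' := by
    intro k k' g g' hg hg' h
    by_contra! hlt
    have h0 := toF_prime_ne_zero hπ
    refine hg'.inv_mul_notMem ?_
    obtain ⟨m, hm⟩ := Int.le.dest (Int.add_one_le_iff.2 hlt)
    have : (toF π)⁻¹ * g' = toF π ^ m * g := by
      rw [← hm, zpow_add₀ h0, zpow_add₀ h0, zpow_one, zpow_natCast, mul_assoc, mul_assoc] at h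
      have h1 := mul_left_cancel₀ (zpow_ne_zero k' h0) h
      rw [← h1, inv_mul_cancel_left₀ h0]
    rw [this]
    exact Subring.mul_mem _ (Subring.pow_mem _ (toF_mem_locRing hπ π) m) hg.2.1
  exact le_antisymm (key hg hg' h) (key hg' hg h.symm)

end LocUnit

namespace CoxSetup

variable (C : CoxSetup n hn hyp W)

theorem α_dvd_sub (H : hyp) (a : SS n) : C.α H ∣ a - C.actS (C.reflW H) a := by
  induction a using MvPolynomial.induction_on with
  | C a =>
    rw [← MvPolynomial.algebraMap_eq, AlgEquiv.commutes, sub_self]; exact dvd_zero _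
  | add p q hp hq =>
    rw [map_add, add_sub_add_comm]; exact dvd_add hp hq
  | mul_X p i hp =>
    obtain ⟨c, hc⟩ := C.reflW_sub (H := H) (X_mem_linForms i)
    have : C.α H ∣ X i - C.actS (C.reflW H) (X i) := by
      rw [hc, smul_eq_C_mul]; exact Dvd.intro_left _ rfl
    rw [map_mul]
    have h2 : p * X i - C.actS (C.reflW H) p * C.actS (C.reflW H) (X i) =
      (p - C.actS (C.reflW H) p) * X i +
        C.actS (C.reflW H) p * (X i - C.actS (C.reflW H) (X i)) := by ring
    rw [h2]
    exact dvd_add (hp.mul_right _) (this.mul_left _)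

theorem not_α_dvd_actS {H : hyp} {a : SS n} (h : ¬ C.α H ∣ a) :
    ¬ C.α H ∣ C.actS (C.reflW H) a := fun h' => h (by
  have := dvd_add (C.α_dvd_sub H a) h'
  rwa [sub_add_cancel] at this)

theorem α_inv_mul_sub_mem {H : hyp} {f : FF n} (hf : f ∈ locRing (C.α H) (C.α_prime H)) :
    (toF (C.α H))⁻¹ * (f - C.actF (C.reflW H) f) ∈ locRing (C.α H) (C.α_prime H) := by
  obtain ⟨s, t, ht, h⟩ := hf
  have ht0 : toF t ≠ 0 := (isLocUnit_toF (hπ := C.α_prime H) ht).1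
  have ht' := C.not_α_dvd_actS ht
  have ht0' : toF (C.actS (C.reflW H) t) ≠ 0 := (isLocUnit_toF (hπ := C.α_prime H) ht').1
  have hα := toF_prime_ne_zero (C.α_prime H)
  have hd : C.α H ∣ s * C.actS (C.reflW H) t - t * C.actS (C.reflW H) s := by
    have : s * C.actS (C.reflW H) t - t * C.actS (C.reflW H) s =
      (s - C.actS (C.reflW H) s) * C.actS (C.reflW H) t -
        (t - C.actS (C.reflW H) t) * C.actS (C.reflW H) s := by ring
    rw [this]
    exact dvd_sub ((C.α_dvd_sub H s).mul_right _) ((C.α_dvd_sub H t).mul_right _)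
  obtain ⟨r, hr⟩ := hd
  refine ⟨r, t * C.actS (C.reflW H) t, (C.α_prime H).not_dvd_mul ht ht', ?_⟩
  have h2 := congrArg (C.actF (C.reflW H)) h
  rw [map_mul, C.actF_compat, C.actF_compat] at h2
  have hr' := congrArg toF hr
  simp only [toF_sub, toF_mul] at hr'
  rw [toF_mul, inv_mul_eq_div, div_mul_eq_mul_div, div_eq_iff hα]
  calc _ = (f * toF t) * toF (C.actS (C.reflW H) t) -
        toF t * (C.actF (C.reflW H) f * toF (C.actS (C.reflW H) t)) := by ring
    _ = _ := by rw [h, h2, hr', mul_comm]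

theorem α_inv_mul_mem_of_anti {H : hyp} {f : FF n} (hf : f ∈ locRing (C.α H) (C.α_prime H))
    (hs : C.actF (C.reflW H) f = -f) :
    (toF (C.α H))⁻¹ * f ∈ locRing (C.α H) (C.α_prime H) := by
  have h := C.α_inv_mul_sub_mem hf
  rw [hs, sub_neg_eq_add, ← two_mul, mul_left_comm] at h
  have : (2 : FF n) * ((toF (C.α H))⁻¹ * f) = (2 : ℝ) • ((toF (C.α H))⁻¹ * f) := by
    rw [Algebra.smul_def, map_ofNat (algebraMap ℝ (FF n)) 2]
  rw [this] at h
  exact mem_locRing_of_smul _ two_ne_zero h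

/-- `δ` preserves the invariant ring. -/
def IsRDer (δ : DerF n) : Prop := ∀ j, ∃ r ∈ Rinv C, δ (toF (C.P j)) = toF r

variable {C}

theorem IsRDer.actF_apply {δ : DerF n} (h : C.IsRDer δ) (w : W) (f : FF n) :
    C.actF w (δ f) = δ (C.actF w f) := by
  refine C.inv_of_P (fun w j => ?_) w f
  obtain ⟨r, hr, hj⟩ := h j
  rw [hj, C.actF_compat, hr]

theorem IsRDer.simple_pole {δ : DerF n} (h : C.IsRDer δ) (H : hyp) {a : SS n}
    (ha : a ∈ linForms n) : toF (C.α H) * δ (toF a) ∈ locRing (C.α H) (C.α_prime H) := by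
  refine C.simple_pole H (fun j => ?_) ha
  obtain ⟨r, hr, hj⟩ := h j
  rw [hj]; exact toF_mem_locRing _ r

theorem IsRDer.simple_pole_toF {δ : DerF n} (h : C.IsRDer δ) (H : hyp) (a : SS n) :
    toF (C.α H) * δ (toF a) ∈ locRing (C.α H) (C.α_prime H) := by
  rw [derF_toF, Finset.mul_sum]
  refine Subring.sum_mem _ fun i _ => ?_
  rw [mul_left_comm]
  exact Subring.mul_mem _ (toF_mem_locRing _ _) (h.simple_pole H (X_mem_linForms i))

theorem IsRDer.simple_pole' {δ : DerF n} (h : C.IsRDer δ) {H : hyp} {f : FF n}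
    (hf : f ∈ locRing (C.α H) (C.α_prime H)) :
    toF (C.α H) * δ f ∈ locRing (C.α H) (C.α_prime H) := by
  obtain ⟨s, t, ht, h'⟩ := hf
  have ht0 : toF t ≠ 0 := (isLocUnit_toF (hπ := C.α_prime H) ht).1
  refine mem_locRing_of_mul _ ht ?_
  have h1 := congrArg δ h'
  rw [Derivation.leibniz, smul_eq_mul, smul_eq_mul] at h1
  have : toF t * (toF (C.α H) * δ f) =
    toF (C.α H) * δ (toF s) - f * (toF (C.α H) * δ (toF t)) := by rw [← h1]; ring
  rw [this]
  exact Subring.sub_mem _ (h.simple_pole_toF H s)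
    (Subring.mul_mem _ ⟨s, t, ht, h'⟩ (h.simple_pole_toF H t))

theorem IsRDer.mem_of_sym {δ : DerF n} (h : C.IsRDer δ) {H : hyp} {f : FF n}
    (hf : f ∈ locRing (C.α H) (C.α_prime H)) (hs : C.actF (C.reflW H) f = f) :
    δ f ∈ locRing (C.α H) (C.α_prime H) := by
  have h1 := C.α_inv_mul_mem_of_anti (h.simple_pole' hf) (by
    rw [map_mul, C.actF_compat, C.reflW_α, h.actF_apply, hs, toF_neg, neg_mul])
  rwa [inv_mul_cancel_left₀ (toF_prime_ne_zero (C.α_prime H))] at h1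

theorem exists_odd_of_anti {H : hyp} {f : FF n} (hf : f ≠ 0) (hs : C.actF (C.reflW H) f = -f) :
    ∃ (k : ℤ) (g : FF n), k ≠ 0 ∧ IsLocUnit (C.α H) (C.α_prime H) g ∧
      C.actF (C.reflW H) g = g ∧ f = toF (C.α H) ^ k * g := by
  obtain ⟨k, g, hg, rfl⟩ := exists_zpow_mul_isLocUnit (C.α_prime H) hf
  have h0 := toF_prime_ne_zero (C.α_prime H)
  have hz := zpow_ne_zero k h0
  have hng : C.actF (C.reflW H) g ≠ -g := fun h =>
    hg.inv_mul_notMem (C.α_inv_mul_mem_of_anti hg.2.1 h)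
  rw [map_mul, map_zpow₀, C.actF_compat, C.reflW_α, toF_neg] at hs
  rcases Int.even_or_odd k with hk | hk
  · rw [hk.neg_zpow, ← mul_neg] at hs
    exact absurd (mul_left_cancel₀ hz hs) hng
  · refine ⟨k, g, ?_, hg, ?_, rfl⟩
    · rintro rfl; simp at hk
    · rw [hk.neg_zpow, neg_mul, neg_inj] at hs
      exact mul_left_cancel₀ hz hs

theorem derF_zpow_mul (δ : DerF n) {a : FF n} (ha : a ≠ 0) (k : ℤ) (g : FF n) :
    δ (a ^ k * g) = a ^ (k - 2) * ((k : ℝ) • (a * δ a * g) + a * (a * δ g)) := by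
  rw [Derivation.leibniz, Derivation.leibniz_zpow]
  have h1 : a ^ k = a ^ (k - 2) * a * a := by
    rw [mul_assoc, ← pow_two, ← zpow_natCast, ← zpow_add₀ ha]; simp
  have h2 : a ^ (k - 1) = a ^ (k - 2) * a := by
    rw [← zpow_add_one₀ ha]; congr 1; ring
  simp only [smul_eq_mul, Algebra.smul_def, zsmul_eq_mul, h2]
  nth_rewrite 1 [h1]
  simp only [map_intCast]
  ring

theorem IsRDer.isLocUnit_or {δ : DerF n} (h : C.IsRDer δ) (H : hyp) :
    IsLocUnit (C.α H) (C.α_prime H) (toF (C.α H) * δ (toF (C.α H))) ∨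
      δ (toF (C.α H)) ∈ locRing (C.α H) (C.α_prime H) := by
  refine (_root_.isLocUnit_or (h.simple_pole H (C.α_mem H))).imp_right fun h => ?_
  rwa [inv_mul_cancel_left₀ (toF_prime_ne_zero (C.α_prime H))] at h

/-- At a pole of `D`, iterated preimages under `D` have orders growing by two. -/
theorem order_of_iterates {D : DerF n} (hD : C.IsRDer D) {H : hyp}
    (hpole : D (toF (C.α H)) ∉ locRing (C.α H) (C.α_prime H)) {f : ℕ → FF n} (h0 : f 0 ≠ 0)
    (hf : ∀ k, C.actF (C.reflW H) (f k) = -f k) (hDf : ∀ k, D (f (k + 1)) = f k) :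
    ∃ e : ℤ, e ≠ 0 ∧ ∀ k : ℕ, ∃ g, IsLocUnit (C.α H) (C.α_prime H) g ∧
      C.actF (C.reflW H) g = g ∧ f k = toF (C.α H) ^ (e + 2 * k) * g := by
  have hne : ∀ k, f k ≠ 0 := by
    intro k
    induction k with
    | zero => exact h0
    | succ k ih => intro h; rw [← hDf, h, map_zero] at ih; exact ih rfl
  have hα := toF_prime_ne_zero (C.α_prime H)
  choose e g he hg hsg hfg using fun k => exists_odd_of_anti (hne k) (hf k)
  have hu := (hD.isLocUnit_or H).resolve_right hpole
  have hstep : ∀ k, e (k + 1) = e k + 2 := by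
    intro k
    have h1 := hDf k
    rw [hfg (k + 1), derF_zpow_mul _ hα] at h1
    have h2 : IsLocUnit (C.α H) (C.α_prime H) ((e (k + 1) : ℝ) •
        (toF (C.α H) * D (toF (C.α H)) * g (k + 1)) +
        toF (C.α H) * (toF (C.α H) * D (g (k + 1)))) := by
      refine IsLocUnit.add_mul ?_ (Subring.mul_mem _ (toF_mem_locRing _ _)
        (hD.mem_of_sym (hg _).2.1 (hsg _)))
      rw [Algebra.smul_def, ← toF_C]
      refine (isLocUnit_toF fun hd => ?_).mul (hu.mul (hg _))
      have hc : IsUnit (MvPolynomial.C (e (k + 1) : ℝ) : SS n) :=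
        (IsUnit.mk0 _ (by exact_mod_cast he (k + 1))).map MvPolynomial.C
      exact (C.α_prime H).not_isUnit (isUnit_of_dvd_unit hd hc)
    rw [hfg k] at h1
    have := eq_of_zpow_mul_eq h2 (hg k) h1
    omega
  refine ⟨e 0, he 0, fun k => ⟨g k, hg k, hsg k, ?_⟩⟩
  have : e k = e 0 + 2 * k := by
    induction k with
    | zero => simp
    | succ k ih => rw [hstep, ih]; push_cast; ring
  rw [← this]; exact hfg k

theorem regular_of_relation {D : DerF n} (hD : C.IsRDer D) {H : hyp}
    (hpole : D (toF (C.α H)) ∉ locRing (C.α H) (C.α_prime H)) {f : ℕ → FF n} (h0 : f 0 ≠ 0)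
    (hf : ∀ k, C.actF (C.reflW H) (f k) = -f k) (hDf : ∀ k, D (f (k + 1)) = f k)
    {θ : ℕ → DerF n} (hθ : ∀ k, C.IsRDer (θ k)) (K : ℕ)
    (hrel : ∑ k ∈ Finset.range (K + 1), θ k (f k) = 0) :
    θ 0 (toF (C.α H)) ∈ locRing (C.α H) (C.α_prime H) := by
  have hα := toF_prime_ne_zero (C.α_prime H)
  obtain ⟨e, he, hk⟩ := order_of_iterates hD hpole h0 hf hDf
  choose g hg hsg hfg using hk
  have h1 : ∀ k ∈ Finset.range K, (toF (C.α H) ^ e)⁻¹ * θ (k + 1) (f (k + 1)) ∈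
      locRing (C.α H) (C.α_prime H) := by
    intro k _
    rw [hfg, derF_zpow_mul _ hα]
    have : e + 2 * ((k + 1 : ℕ) : ℤ) - 2 = e + (2 * k : ℕ) := by push_cast; ring
    rw [this, zpow_add₀ hα, zpow_natCast, mul_assoc, inv_mul_cancel_left₀ (zpow_ne_zero _ hα)]
    refine Subring.mul_mem _ (Subring.pow_mem _ (toF_mem_locRing _ _) _) (Subring.add_mem _
      (smul_mem_locRing _ _ (Subring.mul_mem _ ((hθ _).simple_pole H (C.α_mem H)) (hg _).2.1))
      (Subring.mul_mem _ (toF_mem_locRing _ _) ((hθ _).simple_pole' (hg _).2.1)))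
  have h2 := Subring.sum_mem _ h1
  rw [Finset.sum_range_succ'] at hrel
  rw [← Finset.mul_sum, eq_neg_of_add_eq_zero_left hrel, mul_neg, neg_mem_iff, hfg,
    derF_zpow_mul _ hα] at h2
  have h3 : e + 2 * ((0 : ℕ) : ℤ) - 2 = e + (-1) + (-1) := by push_cast; ring
  rw [h3, zpow_add₀ hα, zpow_add₀ hα, mul_assoc, mul_assoc,
    inv_mul_cancel_left₀ (zpow_ne_zero _ hα)] at h2
  simp only [Nat.cast_zero, mul_zero, add_zero, zpow_neg_one, mul_add,
    inv_mul_cancel_left₀ hα] at h2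
  have h4 := Subring.sub_mem _ h2 ((hθ 0).mem_of_sym (hg 0).2.1 (hsg 0))
  rw [add_sub_cancel_right, mul_smul_comm, mul_smul_comm] at h4
  have h5 := Subring.mul_mem _ (mem_locRing_of_smul _ (by exact_mod_cast he) h4) (hg 0).2.2
  rw [mul_assoc (toF (C.α H)) , inv_mul_cancel_left₀ hα, mul_assoc, mul_assoc,
    mul_inv_cancel₀ (hg 0).1, mul_one] at h5
  have h6 := Subring.mul_mem _ (toF_mem_locRing (C.α_prime H) (C.α H)) h5
  rwa [mul_inv_cancel_left₀ hα] at h6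

/-- Regularity of `θ(α_H)` gives regularity of `θ` on all linear forms. -/
theorem IsRDer.regular_linForms {δ : DerF n} (h : C.IsRDer δ) {H : hyp}
    (hα : δ (toF (C.α H)) ∈ locRing (C.α H) (C.α_prime H)) {a : SS n} (ha : a ∈ linForms n) :
    δ (toF a) ∈ locRing (C.α H) (C.α_prime H) := by
  obtain ⟨c, hc⟩ := C.reflW_sub (H := H) ha
  have h1 : C.actF (C.reflW H) (toF (a - (c / 2) • C.α H)) = toF (a - (c / 2) • C.α H) := by
    rw [C.actF_compat, map_sub, map_smul, C.reflW_α, toF_inj]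
    have : C.actS (C.reflW H) a = a - c • C.α H := by rw [← hc]; abel
    rw [this]; module
  have h2 := h.mem_of_sym (toF_mem_locRing _ _) h1
  rw [toF_sub, map_sub, toF_smul, Derivation.map_smul] at h2
  simpa using Subring.add_mem _ h2 (smul_mem_locRing _ (c / 2) hα)

end CoxSetup

section KerField

/-- The field of constants of a derivation of `F`. -/
def kerField (D : DerF n) : IntermediateField ℝ (FF n) where
  carrier := {f | D f = 0}
  mul_mem' := by
    intro a b ha hb
    simp only [Set.mem_ofPred_eq] at *
    rw [Derivation.leibniz, ha, hb, smul_zero, smul_zero, add_zero]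
  add_mem' := by
    intro a b ha hb
    simp only [Set.mem_ofPred_eq] at *
    rw [map_add, ha, hb, add_zero]
  algebraMap_mem' r := D.map_algebraMap r
  inv_mem' := by
    intro a ha
    simp only [Set.mem_ofPred_eq] at *
    rw [Derivation.leibniz_inv, ha, smul_zero]

theorem mem_kerField {D : DerF n} {f : FF n} : f ∈ kerField D ↔ D f = 0 := Iff.rfl

/-- A derivation of `F` is linear over its field of constants. -/
def kerDer (D : DerF n) : Derivation (kerField D) (FF n) (FF n) :=
  Derivation.mk'
    { toFun := D
      map_add' := map_add D
      map_smul' := fun k f => by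
        rw [Algebra.smul_def, Derivation.leibniz]
        change _ + f • D (k : FF n) = _
        rw [mem_kerField.1 k.2, smul_zero, add_zero, smul_eq_mul, RingHom.id_apply,
          Algebra.smul_def] }
    (fun a b => D.leibniz a b)

theorem kerDer_apply (D : DerF n) (f : FF n) : kerDer D f = D f := rfl

end KerField

namespace CoxSetup

variable (C : CoxSetup n hn hyp W)

/-- The last basic invariant, as an element of `F`. -/
def tP : FF n := toF (C.P (lastIdx n hn))

theorem Dprim_tP : Dprim C C.tP = 1 := by
  rw [Dprim, tP, C.dP_eq, if_pos rfl]

theorem Dprim_P {j : Fin n} (hj : j ≠ lastIdx n hn) : Dprim C (toF (C.P j)) = 0 := by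
  rw [Dprim, C.dP_eq, if_neg hj.symm]

theorem toF_mem_of_mem_Rinv {A : Type*} [SetLike A (FF n)] [SubringClass A (FF n)] (O : A)
    (hc : ∀ c : ℝ, algebraMap ℝ (FF n) c ∈ O) (hP : ∀ j, toF (C.P j) ∈ O) {r : SS n}
    (hr : r ∈ Rinv C) : toF r ∈ O := by
  have := C.P_gen r hr
  clear hr
  induction this using Algebra.adjoin_induction with
  | mem x hx => obtain ⟨j, rfl⟩ := hx; exact hP j
  | algebraMap c => rw [MvPolynomial.algebraMap_eq, toF_C]; exact hc c
  | add x y _ _ ihx ihy => rw [toF_add]; exact add_mem ihx ihy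
  | mul x y _ _ ihx ihy => rw [toF_mul]; exact mul_mem ihx ihy

theorem isIntegral_of_subfield (E : Subfield (FF n)) (hE : ∀ r ∈ Rinv C, toF r ∈ E) (a : SS n) :
    IsIntegral E (toF a) := by
  have hl : (C.orbitPoly a).map (algebraMap (SS n) (FF n)) ∈
      Polynomial.lifts (algebraMap E (FF n)) := by
    rw [Polynomial.lifts_iff_coeff_lifts]
    intro i
    rw [Polynomial.coeff_map]
    exact ⟨⟨_, hE _ (C.orbitPoly_coeff_mem a i)⟩, rfl⟩
  obtain ⟨q, hq, -, hmon⟩ := Polynomial.lifts_and_natDegree_eq_and_monic hl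
    ((C.orbitPoly_monic a).map _)
  refine ⟨q, hmon, ?_⟩
  rw [← Polynomial.eval_map, hq, Polynomial.eval_map, ← Polynomial.aeval_def]
  change Polynomial.aeval (algebraMap (SS n) (FF n) a) _ = 0
  rw [Polynomial.aeval_algebraMap_apply, Polynomial.coe_aeval_eq_eval, orbitPoly_eval, map_zero]

theorem finiteDimensional_adjoin :
    FiniteDimensional ((kerField (Dprim C))⟮(C.tP)⁻¹⟯) (FF n) := by
  set E := (kerField (Dprim C))⟮(C.tP)⁻¹⟯ with hE
  have hK : ∀ f : FF n, Dprim C f = 0 → f ∈ E := fun f hf =>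
    E.algebraMap_mem ⟨f, mem_kerField.2 hf⟩
  have ht : C.tP ∈ E := by
    have := E.inv_mem (IntermediateField.mem_adjoin_simple_self (kerField (Dprim C)) (C.tP)⁻¹)
    rwa [inv_inv] at this
  have hR : ∀ r ∈ Rinv C, toF r ∈ E := fun r hr =>
    C.toF_mem_of_mem_Rinv E (fun c => hK _ (Derivation.map_algebraMap _ c)) (fun j => by
      by_cases hj : j = lastIdx n hn
      · rw [hj]; exact ht
      · exact hK _ (C.Dprim_P hj)) hr
  have hint : ∀ i : Fin n, IsIntegral E (XF i) := fun i =>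
    C.isIntegral_of_subfield E.toSubfield hR (X i)
  have hfd : FiniteDimensional E (IntermediateField.adjoin E (Set.range (XF (n := n)))) :=
    IntermediateField.finiteDimensional_adjoin (by rintro _ ⟨i, rfl⟩; exact hint i)
  have htop : IntermediateField.adjoin E (Set.range (XF (n := n))) = ⊤ := by
    rw [eq_top_iff]
    intro f _
    have hS : ∀ s : SS n, toF s ∈ IntermediateField.adjoin E (Set.range (XF (n := n))) := by
      intro s
      induction s using MvPolynomial.induction_on with
      | C a =>
        rw [toF_C]
        exact IntermediateField.algebraMap_mem _
          (⟨_, hK _ (Derivation.map_algebraMap _ a)⟩ : E)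
      | add p q hp hq => rw [toF_add]; exact add_mem hp hq
      | mul_X p i hp =>
        rw [toF_mul]
        exact mul_mem hp (IntermediateField.subset_adjoin _ _ ⟨i, rfl⟩)
    obtain ⟨a, b, -, rfl⟩ := exists_toF_div f
    exact div_mem (hS a) (hS b)
  rw [htop] at hfd
  exact Module.Finite.equiv (IntermediateField.topEquiv (F := E) (E := FF n)).toLinearEquiv

theorem exists_iterate_eq_zero {r : SS n} (hr : r ∈ Rinv C) :
    ∃ k : ℕ, (Dprim C)^[k] (toF r) = 0 := by
  have h1 : toF r ∈ Algebra.adjoin (kerField (Dprim C)) {C.tP} :=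
    C.toF_mem_of_mem_Rinv _ (fun c => Subalgebra.algebraMap_mem _
      (⟨_, mem_kerField.2 (Derivation.map_algebraMap _ c)⟩ : kerField (Dprim C))) (fun j => by
      by_cases hj : j = lastIdx n hn
      · rw [hj]; exact Algebra.subset_adjoin rfl
      · exact Subalgebra.algebraMap_mem _
          (⟨_, mem_kerField.2 (C.Dprim_P hj)⟩ : kerField (Dprim C))) hr
  rw [Algebra.adjoin_singleton_eq_range_aeval] at h1
  obtain ⟨p, hp⟩ := h1
  have key : ∀ (k : ℕ), (Dprim C)^[k] (Polynomial.aeval C.tP p) =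
      Polynomial.aeval C.tP (Polynomial.derivative^[k] p) := by
    intro k
    induction k with
    | zero => rfl
    | succ k ih =>
      rw [Function.iterate_succ_apply', Function.iterate_succ_apply', ih, ← kerDer_apply,
        Derivation.map_aeval, kerDer_apply, Dprim_tP, smul_eq_mul, mul_one]
  refine ⟨p.natDegree + 1, ?_⟩
  change Polynomial.aeval C.tP p = toF r at hp
  rw [← hp, key, Polynomial.iterate_derivative_eq_zero (Nat.lt_succ_self _), map_zero]

theorem exists_valuation : ∃ v : Valuation (FF n) ℤᵐ⁰,
    (∀ f, Dprim C f = 0 → f ≠ 0 → v f = 1) ∧ 1 < v C.tP ∧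
      ∀ f, v (Dprim C f) * v C.tP ≤ v f := by
  have := C.finiteDimensional_adjoin
  obtain ⟨v, h1, h2, h3⟩ := exists_valuation_at_infinity (kerDer (Dprim C)) (t := C.tP)
    (C.Dprim_tP)
  refine ⟨v, fun f hf hf0 => ?_, h2, h3⟩
  exact Valuation.algebraMap_eq_one_of_le v h1
    (c := (⟨f, mem_kerField.2 hf⟩ : kerField (Dprim C))) (fun h => hf0 (congrArg Subtype.val h))

theorem Dprim_mem_Rinv {r : SS n} (hr : r ∈ Rinv C) : ∃ s ∈ Rinv C, Dprim C (toF r) = toF s := by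
  have := C.P_gen r hr
  clear hr
  induction this using Algebra.adjoin_induction with
  | mem x hx =>
    obtain ⟨j, rfl⟩ := hx
    by_cases hj : j = lastIdx n hn
    · refine ⟨1, fun w => map_one _, ?_⟩
      rw [hj, toF_one]; exact C.Dprim_tP
    · exact ⟨0, fun w => map_zero _, by rw [C.Dprim_P hj, toF_zero]⟩
  | algebraMap c =>
    exact ⟨0, fun w => map_zero _, by rw [MvPolynomial.algebraMap_eq, derF_toF_C, toF_zero]⟩
  | add x y _ _ ihx ihy =>
    obtain ⟨a, ha, hax⟩ := ihx
    obtain ⟨b, hb, hby⟩ := ihy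
    exact ⟨a + b, fun w => by rw [map_add, ha, hb], by rw [toF_add, map_add, hax, hby, toF_add]⟩
  | mul x y hx hy ihx ihy =>
    obtain ⟨a, ha, hax⟩ := ihx
    obtain ⟨b, hb, hby⟩ := ihy
    refine ⟨x * b + y * a, fun w => ?_, ?_⟩
    · rw [map_add, map_mul, map_mul, ha, hb, C.adjoin_le_Rinv hx, C.adjoin_le_Rinv hy]
    · rw [toF_mul, Derivation.leibniz, hax, hby, toF_add, toF_mul, toF_mul, smul_eq_mul,
        smul_eq_mul]

variable {C} in
/-- An invariant polynomial vanishing at infinity is zero. -/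
theorem eq_zero_of_valuation_lt_one {v : Valuation (FF n) ℤᵐ⁰}
    (h1 : ∀ f, Dprim C f = 0 → f ≠ 0 → v f = 1) (h2 : 1 < v C.tP)
    (h3 : ∀ f, v (Dprim C f) * v C.tP ≤ v f) {r : SS n} (hr : r ∈ Rinv C) (hv : v (toF r) < 1) :
    r = 0 := by
  obtain ⟨k, hk⟩ := C.exists_iterate_eq_zero hr
  induction k generalizing r with
  | zero => exact toF_eq_zero.1 hk
  | succ k ih =>
    rw [Function.iterate_succ_apply] at hk
    obtain ⟨s, hs, hrs⟩ := C.Dprim_mem_Rinv hr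
    rw [hrs] at hk
    have hvs : v (toF s) < 1 := by
      rw [← hrs]
      refine lt_of_le_of_lt ?_ hv
      calc v (Dprim C (toF r)) = v (Dprim C (toF r)) * 1 := (mul_one _).symm
        _ ≤ v (Dprim C (toF r)) * v C.tP := by gcongr
        _ ≤ _ := h3 _
    have := ih hs hvs hk
    rw [this, toF_zero] at hrs
    by_contra hr0
    exact hv.ne (h1 _ hrs (by rwa [Ne, toF_eq_zero]))

variable {C} in
theorem Dprim_eq_zero_of_valuation_lt {v : Valuation (FF n) ℤᵐ⁰}
    (h1 : ∀ f, Dprim C f = 0 → f ≠ 0 → v f = 1) (h2 : 1 < v C.tP)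
    (h3 : ∀ f, v (Dprim C f) * v C.tP ≤ v f) {r : SS n} (hr : r ∈ Rinv C)
    (hv : v (toF r) < v C.tP) : Dprim C (toF r) = 0 := by
  obtain ⟨s, hs, hrs⟩ := C.Dprim_mem_Rinv hr
  rw [hrs, toF_eq_zero]
  refine eq_zero_of_valuation_lt_one h1 h2 h3 hs ?_
  rw [← hrs]
  by_contra! hle
  refine absurd (h3 (toF r)) (not_le.2 (hv.trans_le ?_))
  calc v C.tP = 1 * v C.tP := (one_mul _).symm
    _ ≤ _ := by gcongr

end CoxSetup

section Homogeneous

theorem coeff_prod_X_sub_C_isHomogeneous {ι : Type*} (s : Finset ι) (b : ι → SS n)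
    (hb : ∀ i, (b i).IsHomogeneous 1) (i k : ℕ) (hik : i + k = s.card) :
    ((∏ w ∈ s, (Polynomial.X - Polynomial.C (b w))).coeff i).IsHomogeneous k := by
  classical
  induction s using Finset.induction_on generalizing i k with
  | empty =>
    obtain ⟨rfl, rfl⟩ : i = 0 ∧ k = 0 := by simpa using hik
    simpa using isHomogeneous_one (Fin n) ℝ
  | insert a s ha ih =>
    rw [Finset.card_insert_of_notMem ha] at hik
    rw [Finset.prod_insert ha, sub_mul, Polynomial.coeff_sub, Polynomial.coeff_C_mul]
    have hb' : ∀ j l, j + l = s.card → (b a * (∏ w ∈ s, (Polynomial.X -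
        Polynomial.C (b w))).coeff j).IsHomogeneous (l + 1) := fun j l hjl => by
      rw [add_comm]; exact (hb a).mul (ih j l hjl)
    cases i with
    | zero =>
      rw [Polynomial.mul_coeff_zero, Polynomial.coeff_X_zero, zero_mul, zero_sub]
      have : k = s.card + 1 := by omega
      rw [this]
      exact (hb' 0 s.card (zero_add _)).neg
    | succ i =>
      rw [Polynomial.coeff_X_mul]
      refine (ih i k (by omega)).sub ?_
      cases k with
      | zero =>
        rw [Polynomial.coeff_eq_zero_of_natDegree_lt, mul_zero]
        · exact isHomogeneous_zero _ _ _
        · have := Polynomial.natDegree_prod_le s fun w => (Polynomial.X - Polynomial.C (b w))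
          simp only [Polynomial.natDegree_X_sub_C, Finset.sum_const, smul_eq_mul, mul_one] at this
          omega
      | succ k => exact hb' (i + 1) k (by omega)

end Homogeneous

namespace CoxSetup

variable (C : CoxSetup n hn hyp W)

theorem d_le (i : Fin n) : C.d i ≤ C.d (lastIdx n hn) :=
  C.d_mono (Fin.le_def.2 (Nat.le_sub_one_of_lt i.2))

theorem orbitPoly_coeff_isHomogeneous {a : SS n} (ha : a.IsHomogeneous 1) {i k : ℕ}
    (hik : i + k = Fintype.card W) : ((C.orbitPoly a).coeff i).IsHomogeneous k :=
  coeff_prod_X_sub_C_isHomogeneous _ _ (fun w => C.actS_lin w a ha) i k hik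

section Growth

variable {C} {v : Valuation (FF n) ℤᵐ⁰}

theorem valuation_toF_le (hc : ∀ c : ℝ, v (algebraMap ℝ (FF n) c) ≤ 1) {μ : ℤᵐ⁰}
    (hμ : ∀ i, v (XF i) ≤ μ) {f : SS n} {m : ℕ} (hf : f.IsHomogeneous m) : v (toF f) ≤ μ ^ m := by
  rw [f.as_sum, toF_sum]
  refine Valuation.map_sum_le v fun a ha => ?_
  rw [monomial_eq, toF_mul, map_mul, toF_C, Finsupp.prod, toF_prod, map_prod]
  have hdeg : a.degree = m := by
    rw [Finsupp.degree_eq_weight_one]; exact hf (mem_support_iff.1 ha)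
  calc _ ≤ 1 * ∏ i ∈ a.support, μ ^ a i := by
        refine mul_le_mul' (hc _) (Finset.prod_le_prod' fun i _ => ?_)
        rw [toF_pow, map_pow]
        exact pow_le_pow_left' (hμ i) _
    _ = μ ^ m := by rw [one_mul, Finset.prod_pow_eq_pow_sum, ← hdeg]; rfl

theorem valuation_hom_lt (h1 : ∀ f, Dprim C f = 0 → f ≠ 0 → v f = 1) {μ : ℤᵐ⁰} (hμ : 1 < μ)
    (ht : v C.tP < μ ^ C.d (lastIdx n hn)) {r : SS n} (hr : r ∈ Rinv C) {m : ℕ} (hm : m ≠ 0)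
    (hrm : r.IsHomogeneous m) : v (toF r) < μ ^ m := by
  have hc : ∀ c : ℝ, v (algebraMap ℝ (FF n) c) ≤ 1 := fun c => by
    by_cases hc : c = 0
    · simp [hc]
    · exact (h1 _ (Derivation.map_algebraMap _ c) (by simpa using hc)).le
  have hmon : ∀ p ∈ Submonoid.closure (Set.range C.P), ∃ k, p.IsHomogeneous k ∧
      v (toF p) ≤ μ ^ k ∧ (k ≠ 0 → v (toF p) < μ ^ k) := by
    intro p hp
    induction hp using Submonoid.closure_induction with
    | mem x hx =>
      obtain ⟨j, rfl⟩ := hx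
      have : v (toF (C.P j)) < μ ^ C.d j := by
        by_cases hj : j = lastIdx n hn
        · rw [hj]; exact ht
        · refine lt_of_le_of_lt ?_ (one_lt_pow' hμ (C.d_pos j).ne')
          by_cases h0 : C.P j = 0
          · rw [h0, toF_zero, map_zero]; exact zero_le_one
          · exact (h1 _ (C.Dprim_P hj) (by rwa [Ne, toF_eq_zero])).le
      exact ⟨C.d j, C.P_hom j, this.le, fun _ => this⟩
    | one => exact ⟨0, isHomogeneous_one _ _, by simp, fun h => absurd rfl h⟩
    | mul x y _ _ ihx ihy =>
      obtain ⟨k, hk, hxk, hxk'⟩ := ihx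
      obtain ⟨l, hl, hyl, hyl'⟩ := ihy
      have hpos : ∀ k, 0 < μ ^ k := fun k => pow_pos (zero_lt_one.trans hμ) k
      refine ⟨k + l, hk.mul hl, ?_, fun hkl => ?_⟩
      · rw [toF_mul, map_mul, pow_add]; exact mul_le_mul' hxk hyl
      · rw [toF_mul, map_mul, pow_add]
        by_cases hk0 : k = 0
        · exact (mul_le_mul_left hxk _).trans_lt
            (mul_lt_mul_of_pos_left (hyl' (by omega)) (hpos k))
        · exact (mul_le_mul_right hyl _).trans_lt (mul_lt_mul_of_pos_right (hxk' hk0) (hpos l))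
  have hspan : r ∈ Submodule.span ℝ (Submonoid.closure (Set.range C.P) : Set (SS n)) := by
    rw [← Algebra.adjoin_eq_span]; exact C.P_gen r hr
  have hcomp : v (toF (homogeneousComponent m r)) < μ ^ m := by
    have hpos : 0 < μ ^ m := pow_pos (zero_lt_one.trans hμ) m
    clear hr hrm
    induction hspan using Submodule.span_induction with
    | mem x hx =>
      obtain ⟨k, hk, -, hk'⟩ := hmon x hx
      by_cases hkm : k = m
      · subst hkm
        rw [homogeneousComponent_eq_self hk]
        exact hk' hm
      · rw [homogeneousComponent_of_mem hk, if_neg (Ne.symm hkm), toF_zero, map_zero]; exact hpos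
    | zero => rw [map_zero, toF_zero, map_zero]; exact hpos
    | add x y _ _ hx hy => rw [map_add, toF_add]; exact Valuation.map_add_lt v hx hy
    | smul c x _ hx =>
      rw [map_smul, toF_smul, Algebra.smul_def, map_mul]
      exact (mul_le_of_le_one_left' (hc c)).trans_lt hx
  rwa [homogeneousComponent_eq_self hrm] at hcomp

theorem pow_le_valuation_tP (h1 : ∀ f, Dprim C f = 0 → f ≠ 0 → v f = 1) {μ : ℤᵐ⁰} (hμ : 1 < μ)
    {i : Fin n} (hi : v (XF i) = μ) : μ ^ C.d (lastIdx n hn) ≤ v C.tP := by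
  by_contra! ht
  have hN := C.orbitPoly_natDegree (X i)
  have hev := C.orbitPoly_eval (X i)
  rw [Polynomial.eval_eq_sum_range, hN, Finset.sum_range_succ] at hev
  have hlead : (C.orbitPoly (X i)).coeff (Fintype.card W) = 1 := by
    rw [← hN]; exact C.orbitPoly_monic _
  rw [hlead, one_mul] at hev
  have hpos : ∀ k, 0 < μ ^ k := fun k => pow_pos (zero_lt_one.trans hμ) k
  have hlt : v (toF (∑ k ∈ Finset.range (Fintype.card W),
      (C.orbitPoly (X i)).coeff k * X i ^ k)) < μ ^ Fintype.card W := by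
    rw [toF_sum]
    refine Valuation.map_sum_lt v (hpos _).ne' fun k hk => ?_
    have hk' := Finset.mem_range.1 hk
    rw [toF_mul, map_mul, toF_pow, map_pow]
    change _ * v (XF i) ^ k < _
    rw [hi]
    have h2 := valuation_hom_lt h1 hμ ht (C.orbitPoly_coeff_mem (X i) k)
      (m := Fintype.card W - k) (by omega)
      (C.orbitPoly_coeff_isHomogeneous (isHomogeneous_X ℝ i) (by omega))
    calc _ < μ ^ (Fintype.card W - k) * μ ^ k := by gcongr; exact hpos k
      _ = _ := by rw [← pow_add]; congr 1; omega
  rw [eq_neg_of_add_eq_zero_left hev, toF_neg, Valuation.map_neg, toF_pow, map_pow] at hlt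
  change v (XF i) ^ _ < _ at hlt
  rw [hi] at hlt
  exact lt_irrefl _ hlt

theorem valuation_pderiv_P_lt (h1 : ∀ f, Dprim C f = 0 → f ≠ 0 → v f = 1) (h2 : 1 < v C.tP)
    (i s : Fin n) : v (toF (pderiv s (C.P i))) < v C.tP := by
  have hc : ∀ c : ℝ, v (algebraMap ℝ (FF n) c) ≤ 1 := fun c => by
    by_cases hc : c = 0
    · simp [hc]
    · exact (h1 _ (Derivation.map_algebraMap _ c) (by simpa using hc)).le
  have : Nonempty (Fin n) := ⟨s⟩
  obtain ⟨i₀, hi₀⟩ := Finite.exists_max fun i => v (XF (n := n) i)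
  have hhom : (pderiv s (C.P i)).IsHomogeneous (C.d i - 1) := (C.P_hom i).pderiv
  have hd : C.d i - 1 < C.d (lastIdx n hn) := by
    have := C.d_le i; have := C.d_pos i; omega
  rcases le_or_gt (v (XF i₀)) 1 with hle | hlt
  · refine lt_of_le_of_lt (valuation_toF_le hc (μ := 1) (fun j => (hi₀ j).trans hle) hhom) ?_
    rwa [one_pow]
  · exact ((valuation_toF_le hc hi₀ hhom).trans_lt (pow_lt_pow_right₀ hlt hd)).trans_le
      (pow_le_valuation_tP h1 hlt rfl)

end Growth

end CoxSetup

section Assoc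

theorem mem_locRing_of_associated {π ρ : SS n} {hπ : Prime π} {hρ : Prime ρ}
    (h : Associated π ρ) {f : FF n} (hf : f ∈ locRing ρ hρ) : f ∈ locRing π hπ := by
  obtain ⟨s, t, ht, h'⟩ := hf
  exact ⟨s, t, fun hd => ht (h.symm.dvd.trans hd), h'⟩

theorem der_toF_mem {O : Subring (FF n)} (hO : ∀ f, toF f ∈ O) {δ : DerF n}
    (h : ∀ i, δ (XF i) ∈ O) (a : SS n) : δ (toF a) ∈ O := by
  rw [derF_toF]
  exact Subring.sum_mem _ fun i _ => Subring.mul_mem _ (hO _) (h i)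

end Assoc

namespace CoxSetup

variable (C : CoxSetup n hn hyp W)

theorem exists_toF_of_local {f : FF n}
    (h1 : ∀ π (hπ : Prime π), (∀ H, ¬ Associated π (C.α H)) → f ∈ locRing π hπ)
    (h2 : ∀ H, f ∈ locRing (C.α H) (C.α_prime H)) : ∃ s, f = toF s := by
  refine exists_toF_of_forall_locRing fun π hπ => ?_
  by_cases h : ∀ H, ¬ Associated π (C.α H)
  · exact h1 π hπ h
  · push Not at h
    obtain ⟨H, hH⟩ := h
    exact mem_locRing_of_associated hH (h2 H)

/-- An invariant rational function with at most simple poles along the arrangement is an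
invariant polynomial. -/
theorem exists_Rinv_of_simple_pole {f : FF n} (hf : ∀ w, C.actF w f = f)
    (h1 : ∀ π (hπ : Prime π), (∀ H, ¬ Associated π (C.α H)) → f ∈ locRing π hπ)
    (h2 : ∀ H, toF (C.α H) * f ∈ locRing (C.α H) (C.α_prime H)) : ∃ r ∈ Rinv C, f = toF r := by
  obtain ⟨s, rfl⟩ := C.exists_toF_of_local h1 fun H => by
    have h3 := C.α_inv_mul_mem_of_anti (h2 H) (by
      rw [map_mul, hf, C.actF_compat, C.reflW_α, toF_neg, neg_mul])
    rwa [inv_mul_cancel_left₀ (toF_prime_ne_zero (C.α_prime H))] at h3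
  exact ⟨s, fun w => toF_injective (by rw [← C.actF_compat, hf]), rfl⟩

variable {C} in
theorem IsRDer.regular_away {δ : DerF n} (h : C.IsRDer δ) {π : SS n} (hπ : Prime π)
    (hna : ∀ H, ¬ Associated π (C.α H)) (a : SS n) : δ (toF a) ∈ locRing π hπ :=
  der_toF_mem (toF_mem_locRing hπ) (fun i => C.regular_of_not_associated hπ hna (fun j => by
    obtain ⟨r, -, hj⟩ := h j
    rw [hj]; exact toF_mem_locRing _ _) (X_mem_linForms i)) a

section Orthogonal

/-- The matrix of `w` acting on linear forms. -/
def orthMat (w : W) : Matrix (Fin n) (Fin n) ℝ :=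
  fun r s => (C.actS w (X s)).coeff (Finsupp.single r 1)

theorem actS_X (w : W) (s : Fin n) : C.actS w (X s) = ∑ r, C.orthMat w r s • X r :=
  linForm_eq (C.actS_mem_linForms w (X_mem_linForms s))

theorem orthMat_transpose_mul (w : W) : (C.orthMat w).transpose * C.orthMat w = 1 := by
  ext s s'
  rw [Matrix.mul_apply]
  refine (C.actS_orth w (X s) (X s') (isHomogeneous_X ℝ s) (isHomogeneous_X ℝ s')).trans ?_
  rw [ip1_X_left, Matrix.one_apply]
  simp [coeff_X, Finsupp.single_left_inj, eq_comm]

theorem sum_orth {O : Matrix (Fin n) (Fin n) ℝ} (hO : O.transpose * O = 1) (f g : Fin n → FF n) :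
    ∑ r, (∑ s, O r s • f s) * (∑ s, O r s • g s) = ∑ s, f s * g s := by
  simp only [Finset.sum_mul_sum, smul_mul_smul_comm]
  rw [Finset.sum_comm]
  refine Finset.sum_congr rfl fun s _ => ?_
  rw [Finset.sum_comm]
  have h : ∀ s', ∑ r, O r s * O r s' = if s = s' then 1 else 0 := fun s' => by
    have := congrFun (congrFun hO s) s'
    rwa [Matrix.mul_apply, Matrix.one_apply] at this
  simp only [← Finset.sum_smul, h]
  simp

theorem actS_pderiv_sum {f : SS n} (hf : f ∈ Rinv C) (w : W) (r : Fin n) :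
    toF (pderiv r f) = ∑ s, C.orthMat w r s • C.actF w (toF (pderiv s f)) := by
  have key : ∀ f : SS n, pderiv r (C.actS w f) =
      ∑ s, C.orthMat w r s • C.actS w (pderiv s f) := by
    intro f
    induction f using MvPolynomial.induction_on with
    | C a =>
      have : C.actS w (MvPolynomial.C a) = MvPolynomial.C a := by
        rw [← MvPolynomial.algebraMap_eq, AlgEquiv.commutes]
      simp [this]
    | add p q hp hq => simp [hp, hq, Finset.sum_add_distrib]
    | mul_X p i hp =>
      have h1 : pderiv r (C.actS w (X i)) = MvPolynomial.C (C.orthMat w r i) := by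
        rw [actS_X, map_sum]
        simp only [Derivation.map_smul, pderiv_X]
        rw [Finset.sum_eq_single r]
        · simp [smul_eq_C_mul]
        · intro b _ hb; simp [hb.symm]
        · simp
      rw [map_mul, Derivation.leibniz, h1, hp]
      simp only [Derivation.leibniz, pderiv_X, smul_eq_mul, map_add, map_mul, smul_add,
        Finset.sum_add_distrib, Finset.mul_sum]
      congr 1
      · rw [Finset.sum_eq_single i]
        · simp [smul_eq_C_mul, mul_comm]
        · intro b _ hb; simp [hb.symm]
        · simp
      · refine Finset.sum_congr rfl fun j _ => by rw [mul_smul_comm]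
  have h1 := key f
  rw [hf w] at h1
  rw [h1, toF_sum]
  simp only [toF_smul, C.actF_compat]

end Orthogonal

section InvariantMatrix

variable {C} in
theorem IsRDer.sum {ι : Type*} {s : Finset ι} {c : ι → SS n} (hc : ∀ i, c i ∈ Rinv C)
    {δ : ι → DerF n} (hδ : ∀ i, C.IsRDer (δ i)) : C.IsRDer (∑ i ∈ s, toF (c i) • δ i) := by
  intro j
  choose r hr hj using fun i => hδ i j
  refine ⟨∑ i ∈ s, c i * r i, fun w => ?_, ?_⟩
  · simp only [map_sum, map_mul]
    exact Finset.sum_congr rfl fun i _ => by rw [hc i w, hr i w]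
  · rw [derF_sum_apply, toF_sum]
    exact Finset.sum_congr rfl fun i _ => by rw [derF_smul_apply, hj, toF_mul]

theorem isRDer_dP (i : Fin n) : C.IsRDer (C.dP i) := by
  intro j
  rw [C.dP_eq]
  split_ifs
  · exact ⟨1, fun w => map_one _, toF_one.symm⟩
  · exact ⟨0, fun w => map_zero _, toF_zero.symm⟩

theorem isRDer_Dprim : C.IsRDer (Dprim C) := C.isRDer_dP _

/-- The gradient derivation `I*(dP_i)`. -/
def grad (i : Fin n) : DerF n := ∑ s, toF (pderiv s (C.P i)) • C.dX s

theorem grad_XF (i s : Fin n) : C.grad i (XF s) = toF (pderiv s (C.P i)) := by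
  rw [grad, derF_sum_apply, Finset.sum_eq_single s]
  · rw [derF_smul_apply, C.dX_eq, if_pos rfl, mul_one]
  · intro j _ hj; rw [derF_smul_apply, C.dX_eq, if_neg hj, mul_zero]
  · simp

theorem isRDer_grad (i : Fin n) : C.IsRDer (C.grad i) := by
  intro j
  refine ⟨∑ s, pderiv s (C.P j) * pderiv s (C.P i), fun w => toF_injective ?_, ?_⟩
  · rw [← C.actF_compat]
    simp only [toF_sum, toF_mul, map_sum, map_mul]
    rw [← sum_orth (C.orthMat_transpose_mul w)]
    refine Finset.sum_congr rfl fun r _ => ?_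
    rw [← C.actS_pderiv_sum (fun w => C.P_inv w j) w r,
      ← C.actS_pderiv_sum (fun w => C.P_inv w i) w r]
  · rw [derF_toF, toF_sum]
    simp only [grad_XF, toF_mul]

theorem exists_matrix_entry (i j : Fin n) : ∃ r ∈ Rinv C,
    ∑ s, Dprim C (toF (pderiv s (C.P i))) * toF (pderiv s (C.P j)) = toF r := by
  refine C.exists_Rinv_of_simple_pole (fun w => ?_) (fun π hπ hna => ?_) fun H => ?_
  · simp only [map_sum, map_mul]
    rw [← sum_orth (C.orthMat_transpose_mul w)]
    refine Finset.sum_congr rfl fun r _ => ?_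
    rw [← C.actS_pderiv_sum (fun w => C.P_inv w j) w r]
    congr 1
    simp only [C.isRDer_Dprim.actF_apply, ← Derivation.map_smul, ← map_sum]
    rw [← C.actS_pderiv_sum (fun w => C.P_inv w i) w r]
  · exact Subring.sum_mem _ fun s _ => Subring.mul_mem _
      (C.isRDer_Dprim.regular_away hπ hna _) (toF_mem_locRing _ _)
  · rw [Finset.mul_sum]
    refine Subring.sum_mem _ fun s _ => ?_
    rw [← mul_assoc]
    exact Subring.mul_mem _ (C.isRDer_Dprim.simple_pole_toF H _) (toF_mem_locRing _ _)

theorem sum_pderiv_mul_dP (r s : Fin n) :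
    ∑ j, toF (pderiv r (C.P j)) * C.dP j (XF s) = if r = s then 1 else 0 := by
  rw [← C.dX_eq r s]
  conv_rhs => rw [C.der_eq_sum (C.dX r), derF_sum_apply]
  refine Finset.sum_congr rfl fun j _ => ?_
  rw [derF_smul_apply, derF_toF (C.dX r), Finset.sum_eq_single r]
  · rw [C.dX_eq, if_pos rfl, mul_one]
  · intro b _ hb; rw [C.dX_eq, if_neg hb.symm, mul_zero]
  · simp

/-- The ring `T`. -/
def Tring : Subring (SS n) where
  carrier := Tker C
  mul_mem' := by
    rintro a b ⟨ha, ha'⟩ ⟨hb, hb'⟩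
    refine ⟨fun w => by rw [map_mul, ha, hb], ?_⟩
    rw [toF_mul, Derivation.leibniz, ha', hb', smul_zero, smul_zero, add_zero]
  one_mem' := ⟨fun w => map_one _, by rw [toF_one, Derivation.map_one_eq_zero]⟩
  add_mem' := by
    rintro a b ⟨ha, ha'⟩ ⟨hb, hb'⟩
    exact ⟨fun w => by rw [map_add, ha, hb], by rw [toF_add, map_add, ha', hb', add_zero]⟩
  zero_mem' := ⟨fun w => map_zero _, by rw [toF_zero, map_zero]⟩
  neg_mem' := by
    rintro a ⟨ha, ha'⟩
    exact ⟨fun w => by rw [map_neg, ha], by rw [toF_neg, map_neg, ha', neg_zero]⟩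

variable {C} in
theorem Dprim_Tring_mul (c : C.Tring) (f : FF n) :
    Dprim C (toF (c : SS n) * f) = toF (c : SS n) * Dprim C f := by
  rw [Derivation.leibniz, c.2.2, smul_zero, add_zero, smul_eq_mul]

end InvariantMatrix

end CoxSetup

namespace CoxSetup

variable (C : CoxSetup n hn hyp W)

section Primitive

theorem eq_zero_of_nabla_Dprim {β : DerF n} (hβ : β ∈ C.Dinf) (hinv : invDer C β)
    (h : ∀ i, Dprim C (β (XF i)) = 0) : β = 0 := by
  have h0 : ∀ δ : DerF n, (∀ i, Dprim C (δ (XF i)) = 0) → C.nabla (Dprim C) δ = 0 := fun δ hδ =>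
    derF_ext fun i => by rw [C.nabla_eq, hδ]; rfl
  have h1 := (C.nablaDinv_spec β hβ hinv).2.2.2
  have h2 := (C.nablaDinv_spec 0 C.Dinf_zero fun w => by ext; simp [conjDer]).2.2.2
  change C.nablaDinv (C.nabla (Dprim C) β) = β at h1
  change C.nablaDinv (C.nabla (Dprim C) 0) = 0 at h2
  rw [h0 β h] at h1
  rw [h0 0 fun i => by rw [Derivation.zero_apply, map_zero]] at h2
  rw [← h1, h2]

variable {C} in
theorem IsRDer.invDer {δ : DerF n} (h : C.IsRDer δ) : invDer C δ := fun w => C.der_ext fun j => by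
  have h1 := C.conjDer_apply w δ (toF (C.P j))
  rw [C.actF_compat, C.P_inv, h.actF_apply, C.actF_compat, C.P_inv] at h1
  exact h1

/-- The combination of gradients with coefficients in `T`. -/
def gradSum (b : Fin n → C.Tring) : DerF n := ∑ i, toF (b i : SS n) • C.grad i

theorem gradSum_XF (b : Fin n → C.Tring) (s : Fin n) :
    C.gradSum b (XF s) = ∑ i, toF (b i : SS n) * toF (pderiv s (C.P i)) := by
  rw [gradSum, derF_sum_apply]
  simp only [derF_smul_apply, grad_XF]

theorem isRDer_gradSum (b : Fin n → C.Tring) : C.IsRDer (C.gradSum b) :=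
  IsRDer.sum (fun i => (b i).2.1) C.isRDer_grad

theorem gradSum_mem_Dinf (b : Fin n → C.Tring) : C.gradSum b ∈ C.Dinf :=
  C.Dinf_poly _ fun s => ⟨∑ i, b i * pderiv s (C.P i), by simp [gradSum_XF]⟩

theorem eq_zero_of_gradSum_eq_zero {b : Fin n → C.Tring} (h : C.gradSum b = 0) : b = 0 := by
  funext j
  have h1 : ∑ s, C.gradSum b (XF s) * C.dP j (XF s) = toF (b j : SS n) := by
    simp only [gradSum_XF, Finset.sum_mul]
    rw [Finset.sum_comm]
    simp only [mul_assoc, ← Finset.mul_sum, ← derF_toF, C.dP_eq]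
    simp
  rw [h] at h1
  simp only [Derivation.zero_apply, zero_mul, Finset.sum_const_zero] at h1
  exact Subtype.ext (toF_eq_zero.1 h1.symm)

theorem Dprim_gradSum {A : Matrix (Fin n) (Fin n) C.Tring}
    (hA : ∀ i s, Dprim C (toF (pderiv s (C.P i))) = ∑ j, toF (A i j : SS n) * C.dP j (XF s))
    (b : Fin n → C.Tring) (s : Fin n) : Dprim C (C.gradSum b (XF s)) =
      ∑ j, toF ((Matrix.vecMul b A j : C.Tring) : SS n) * C.dP j (XF s) := by
  rw [gradSum_XF, map_sum]
  simp only [Dprim_Tring_mul, hA, Matrix.vecMul, dotProduct, AddSubmonoidClass.coe_finsetSum,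
    Subring.coe_mul, toF_sum, toF_mul, Finset.sum_mul, Finset.mul_sum, mul_assoc]
  rw [Finset.sum_comm]

/-- The matrix expressing `∇_D I*(dP_i)` in terms of the `∂_{P_j}` has coefficients in `T` and
nonzero determinant. -/
theorem exists_matrix {v : Valuation (FF n) ℤᵐ⁰} (h1 : ∀ f, Dprim C f = 0 → f ≠ 0 → v f = 1)
    (h2 : 1 < v C.tP) (h3 : ∀ f, v (Dprim C f) * v C.tP ≤ v f) :
    ∃ A : Matrix (Fin n) (Fin n) C.Tring, A.det ≠ 0 ∧ ∀ i s,
      Dprim C (toF (pderiv s (C.P i))) = ∑ j, toF (A i j : SS n) * C.dP j (XF s) := by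
  have hpos : 0 < v C.tP := zero_lt_one.trans h2
  choose a haR ha using C.exists_matrix_entry
  have haT : ∀ i j, a i j ∈ C.Tring := fun i j => by
    refine ⟨haR i j, Dprim_eq_zero_of_valuation_lt h1 h2 h3 (haR i j) ?_⟩
    rw [← ha]
    refine Valuation.map_sum_lt v hpos.ne' fun s _ => ?_
    rw [map_mul]
    have hle : v (Dprim C (toF (pderiv s (C.P i)))) ≤ 1 := by
      by_contra! hlt
      refine absurd ((h3 _).trans_lt (valuation_pderiv_P_lt h1 h2 i s)) (not_lt.2 ?_)
      exact le_mul_of_one_le_left' hlt.le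
    exact (mul_le_of_le_one_left' hle).trans_lt (valuation_pderiv_P_lt h1 h2 j s)
  have hA : ∀ i s, Dprim C (toF (pderiv s (C.P i))) = ∑ j, toF (a i j) * C.dP j (XF s) := by
    intro i s
    simp only [← ha, Finset.sum_mul]
    rw [Finset.sum_comm]
    simp only [mul_assoc, ← Finset.mul_sum, sum_pderiv_mul_dP]
    simp
  refine ⟨fun i j => ⟨a i j, haT i j⟩, fun hdet => ?_, hA⟩
  obtain ⟨b, hb0, hb⟩ := Matrix.exists_vecMul_eq_zero_iff.2 hdet
  refine hb0 (C.eq_zero_of_gradSum_eq_zero (C.eq_zero_of_nabla_Dprim (C.gradSum_mem_Dinf b)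
    (C.isRDer_gradSum b).invDer fun s => ?_))
  rw [C.Dprim_gradSum (A := fun i j => ⟨a i j, haT i j⟩) hA, hb]
  simp

theorem sum_sq_eq_zero {p : Fin n → SS n} (h : ∑ s, p s * p s = 0) (s : Fin n) : p s = 0 := by
  refine MvPolynomial.funext fun x => ?_
  have h1 := congrArg (eval x) h
  simp only [map_sum, map_mul, map_zero] at h1
  rw [map_zero]
  exact mul_self_eq_zero.1
    ((Finset.sum_eq_zero_iff_of_nonneg fun i _ => mul_self_nonneg _).1 h1 s (Finset.mem_univ s))

/-- No nonzero `T`-combination of the `∂_{P_j}` preserves the polynomial ring. -/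
theorem eq_zero_of_isPolyDer (c : Fin n → C.Tring)
    (hc : IsPolyDer (∑ j, toF (c j : SS n) • C.dP j)) (j : Fin n) : c j = 0 := by
  obtain ⟨v, h1, h2, h3⟩ := C.exists_valuation
  have hpos : 0 < v C.tP := zero_lt_one.trans h2
  have hTle : ∀ b : C.Tring, v (toF (b : SS n)) ≤ 1 := fun b => by
    by_cases hb : (b : SS n) = 0
    · rw [hb, toF_zero, map_zero]; exact zero_le_one
    · exact (h1 _ b.2.2 (by rwa [Ne, toF_eq_zero])).le
  obtain ⟨A, hdet, hA⟩ := C.exists_matrix h1 h2 h3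
  set δ : DerF n := ∑ j, toF (c j : SS n) • C.dP j with hδ
  have hδR : C.IsRDer δ := IsRDer.sum (fun i => (c i).2.1) C.isRDer_dP
  choose p hp using hc
  have hvp : ∀ s, v (δ (XF s)) < 1 := by
    intro s
    set b := Matrix.vecMul c A.adjugate with hb
    have hbA : Matrix.vecMul b A = A.det • c := by
      rw [hb, Matrix.vecMul_vecMul, Matrix.adjugate_mul, Matrix.vecMul_smul, Matrix.vecMul_one]
    have h4 : Dprim C (C.gradSum b (XF s)) = toF ((A.det : C.Tring) : SS n) * δ (XF s) := by
      rw [C.Dprim_gradSum hA, hbA, hδ, derF_sum_apply, Finset.mul_sum]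
      simp [derF_smul_apply, mul_assoc]
    have h5 : v (C.gradSum b (XF s)) < v C.tP := by
      rw [gradSum_XF]
      refine Valuation.map_sum_lt v hpos.ne' fun i _ => ?_
      rw [map_mul]
      exact (mul_le_of_le_one_left' (hTle _)).trans_lt (valuation_pderiv_P_lt h1 h2 i s)
    have h6 := h3 (C.gradSum b (XF s))
    rw [h4, map_mul, h1 _ A.det.2.2 (by
      rw [Ne, toF_eq_zero]; exact fun h => hdet (Subtype.ext h)), one_mul] at h6
    by_contra! hle
    exact absurd (h6.trans_lt h5) (not_lt.2 (le_mul_of_one_le_left' hle))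
  have hr : ∑ s, p s * p s ∈ Rinv C := by
    intro w
    refine toF_injective ?_
    rw [← C.actF_compat]
    simp only [toF_sum, toF_mul, ← hp, map_sum, map_mul]
    have hO : (C.orthMat w).transpose.transpose * (C.orthMat w).transpose = 1 :=
      mul_eq_one_comm.1 (by
        rw [Matrix.transpose_transpose]; exact C.orthMat_transpose_mul w)
    refine Eq.trans ?_ (sum_orth hO (fun r => δ (XF r)) fun r => δ (XF r))
    refine Finset.sum_congr rfl fun s _ => ?_
    have : C.actF w (δ (XF s)) = ∑ r, (C.orthMat w).transpose s r • δ (XF r) := by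
      rw [hδR.actF_apply, C.actF_apply_XF, C.actS_X, toF_sum, map_sum]
      simp only [toF_smul, Derivation.map_smul]
      rfl
    rw [this]
  have hr0 := eq_zero_of_valuation_lt_one h1 h2 h3 hr (by
    rw [toF_sum]
    refine Valuation.map_sum_lt v one_ne_zero fun s _ => ?_
    rw [toF_mul, ← hp, map_mul]
    exact mul_lt_one_of_nonneg_of_lt_one_left (zero_le) (hvp s) (hvp s).le)
  have hδ0 : δ = 0 := derF_ext fun s => by
    rw [hp, sum_sq_eq_zero hr0, toF_zero]; rfl
  have h7 : δ (toF (C.P j)) = toF (c j : SS n) := by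
    rw [hδ, derF_sum_apply, Finset.sum_eq_single j]
    · rw [derF_smul_apply, C.dP_eq, if_pos rfl, mul_one]
    · intro i _ hi; rw [derF_smul_apply, C.dP_eq, if_neg hi, mul_zero]
    · simp
  rw [hδ0] at h7
  exact Subtype.ext (toF_eq_zero.1 h7.symm)

end Primitive

end CoxSetup

namespace CoxSetup

variable (C : CoxSetup n hn hyp W)

section NonPole

theorem actF_mem_locRing {H H' : hyp} {w : W} {c : ℝ} (hc : c ≠ 0)
    (h : C.actS w (C.α H) = c • C.α H') {f : FF n} (hf : f ∈ locRing (C.α H) (C.α_prime H)) :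
    C.actF w f ∈ locRing (C.α H') (C.α_prime H') := by
  obtain ⟨s, t, ht, h'⟩ := hf
  refine ⟨C.actS w s, C.actS w t, fun hd => ht ?_, ?_⟩
  · have h1 : C.actS w (C.α H) ∣ C.actS w t := by
      rw [h, smul_eq_C_mul]
      exact (((isUnit_iff_ne_zero.2 hc).map (MvPolynomial.C : ℝ →+* SS n)).mul_left_dvd).2 hd
    exact (map_dvd_iff (C.actS w)).1 h1
  · rw [← C.actF_compat, ← C.actF_compat, ← h', map_mul]

/-- There is a nonzero element of `T` divisible by every `α_H` such that `D α_H` has no pole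
along `H`. -/
theorem exists_Tker_dvd : ∃ N ∈ Tker C, N ≠ 0 ∧ ∀ H,
    Dprim C (toF (C.α H)) ∈ locRing (C.α H) (C.α_prime H) → C.α H ∣ N := by
  classical
  set D := Dprim C with hDdef
  have hD : C.IsRDer D := C.isRDer_Dprim
  set A : Finset hyp := Finset.univ.filter fun H => D (toF (C.α H)) ∈
    locRing (C.α H) (C.α_prime H) with hA
  set N : SS n := ∏ w : W, ∏ H ∈ A, C.actS w (C.α H) with hN
  have hfac : ∀ (w : W), ∀ H ∈ A, ∃ (H' : hyp) (c : ℝ), c ≠ 0 ∧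
      C.actS w (C.α H) = c • C.α H' ∧ D (toF (C.α H')) ∈ locRing (C.α H') (C.α_prime H') := by
    intro w H hH
    obtain ⟨c, hc, h⟩ := C.σ_compat w H
    refine ⟨_, c, hc, h, ?_⟩
    have h1 := C.actF_mem_locRing hc h (Finset.mem_filter.1 hH).2
    rw [hD.actF_apply, C.actF_compat, h, toF_smul, Derivation.map_smul] at h1
    exact mem_locRing_of_smul _ hc h1
  have hNR : N ∈ Rinv C := by
    intro w
    rw [hN, map_prod]
    refine Fintype.prod_equiv (Equiv.mulLeft w) _ _ fun w' => ?_
    rw [map_prod]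
    exact Finset.prod_congr rfl fun H _ => (C.actS_mul_apply w w' _).symm
  have hN0 : N ≠ 0 := Finset.prod_ne_zero_iff.2 fun w _ => Finset.prod_ne_zero_iff.2 fun H _ =>
    (map_ne_zero_iff _ (C.actS w).injective).2 (C.α_ne H)
  have hN0' : toF N ≠ 0 := fun h => hN0 (toF_eq_zero.1 h)
  refine ⟨N, ⟨hNR, ?_⟩, hN0, fun H hH => ?_⟩
  · have hpole : ∀ H, toF N ≠ 0 ∧
        toF (C.α H) * (D (toF N) / toF N) ∈ locRing (C.α H) (C.α_prime H) := by
      intro H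
      have hmul : ∀ a b : SS n,
          (toF a ≠ 0 ∧ toF (C.α H) * (D (toF a) / toF a) ∈ locRing (C.α H) (C.α_prime H)) →
          (toF b ≠ 0 ∧ toF (C.α H) * (D (toF b) / toF b) ∈ locRing (C.α H) (C.α_prime H)) →
          (toF (a * b) ≠ 0 ∧
            toF (C.α H) * (D (toF (a * b)) / toF (a * b)) ∈ locRing (C.α H) (C.α_prime H)) := by
        rintro a b ⟨ha, ha'⟩ ⟨hb, hb'⟩
        refine ⟨by rw [toF_mul]; exact mul_ne_zero ha hb, ?_⟩
        have : toF (C.α H) * (D (toF (a * b)) / toF (a * b)) =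
            toF (C.α H) * (D (toF a) / toF a) + toF (C.α H) * (D (toF b) / toF b) := by
          rw [toF_mul, Derivation.leibniz, smul_eq_mul, smul_eq_mul]
          field_simp
          ring
        rw [this]
        exact Subring.add_mem _ ha' hb'
      have hone : toF (1 : SS n) ≠ 0 ∧
          toF (C.α H) * (D (toF 1) / toF 1) ∈ locRing (C.α H) (C.α_prime H) := by
        simp
      refine Finset.prod_induction _ (fun a => toF a ≠ 0 ∧
        toF (C.α H) * (D (toF a) / toF a) ∈ locRing (C.α H) (C.α_prime H)) hmul hone
        fun w _ => Finset.prod_induction _ (fun a => toF a ≠ 0 ∧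
        toF (C.α H) * (D (toF a) / toF a) ∈ locRing (C.α H) (C.α_prime H)) hmul hone
        fun H₁ hH₁ => ?_
      obtain ⟨H', c, hc, h, hreg⟩ := hfac w H₁ hH₁
      have h0 : toF (C.α H') ≠ 0 := toF_prime_ne_zero (C.α_prime H')
      rw [h, toF_smul, Derivation.map_smul, Algebra.smul_def, Algebra.smul_def,
        mul_div_mul_left _ _ ((map_ne_zero _).2 hc)]
      refine ⟨mul_ne_zero ((map_ne_zero _).2 hc) h0, ?_⟩
      by_cases hHH : H = H'
      · subst hHH
        rwa [mul_div_cancel₀ _ h0]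
      · rw [mul_div_assoc', div_eq_mul_inv]
        exact Subring.mul_mem _ (hD.simple_pole_toF H _)
          (inv_toF_mem_locRing _ fun hd => hHH (C.eq_of_α_dvd hd))
    obtain ⟨g, hg, hgN⟩ := C.exists_Rinv_of_simple_pole (f := D (toF N) / toF N)
      (fun w => by rw [map_div₀, hD.actF_apply, C.actF_compat, hNR])
      (fun π hπ hna => by
        rw [div_eq_mul_inv]
        refine Subring.mul_mem _ (hD.regular_away hπ hna N) (inv_toF_mem_locRing _ fun hd => ?_)
        obtain ⟨w, -, hd⟩ := hπ.exists_mem_finset_dvd hd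
        obtain ⟨H, hH, hd⟩ := hπ.exists_mem_finset_dvd hd
        obtain ⟨H', c, hc, h, -⟩ := hfac w H hH
        have hu : IsUnit (MvPolynomial.C c : SS n) := (isUnit_iff_ne_zero.2 hc).map _
        rw [h, smul_eq_C_mul, hu.dvd_mul_left] at hd
        exact hna H' (hπ.associated_of_dvd (C.α_prime H') hd))
      fun H => (hpole H).2
    obtain ⟨v, h1, h2, h3⟩ := C.exists_valuation
    have hpos : 0 < v C.tP := zero_lt_one.trans h2
    have hDN : D (toF N) = toF g * toF N := by rw [← hgN, div_mul_cancel₀ _ hN0']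
    have hg0 := eq_zero_of_valuation_lt_one h1 h2 h3 hg (by
      by_contra! hle
      have h4 := h3 (toF N)
      rw [← hDdef, hDN, map_mul] at h4
      have h5 : v (toF N) * v C.tP ≤ v (toF N) :=
        (mul_le_mul_left (le_mul_of_one_le_left' hle) _).trans h4
      have h6 : 0 < v (toF N) := zero_lt_iff.2 ((Valuation.ne_zero_iff v).2 hN0')
      exact absurd h5 (not_le.2 (lt_mul_of_one_lt_right h6 h2)))
    rw [← hDdef, hDN, hg0, toF_zero, zero_mul]
  · refine Dvd.dvd.trans ?_ (Finset.dvd_prod_of_mem _ (Finset.mem_univ (1 : W)))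
    refine Dvd.dvd.trans ?_ (Finset.dvd_prod_of_mem _
      (Finset.mem_filter.2 ⟨Finset.mem_univ H, hH⟩))
    rw [actS_one_apply]

end NonPole

section Universal

theorem nabla_zero (δ : DerF n) : C.nabla 0 δ = 0 := derF_ext fun i => by
  rw [C.nabla_eq]; rfl

variable {C} in
/-- A universal derivation does not vanish on any nonzero linear form. -/
theorem linForm_ne_zero_of_isUniversal {m : hyp → ℤ} {ζ : DerF n} (hζ : isUniversal C m ζ)
    {a : SS n} (ha : a ∈ linForms n) (ha0 : a ≠ 0) : ζ (toF a) ≠ 0 := by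
  intro h
  set M : Matrix (Fin n) (Fin n) (FF n) := fun i s => C.dX s (ζ (XF i)) with hM
  have hrow : ∃ u : Fin n → FF n, u ≠ 0 ∧ Matrix.vecMul u M = 0 := by
    refine ⟨fun i => algebraMap ℝ (FF n) (a.coeff (Finsupp.single i 1)), fun hu => ha0 ?_, ?_⟩
    · rw [linForm_eq ha]
      refine Finset.sum_eq_zero fun i _ => ?_
      rw [(map_eq_zero _).1 (congrFun hu i), zero_smul]
    · funext s
      rw [derF_linForm ζ ha] at h
      have h1 := congrArg (C.dX s) h
      simp only [map_sum, Derivation.map_smul, map_zero] at h1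
      simpa [Matrix.vecMul, dotProduct, hM, Algebra.smul_def] using h1
  obtain ⟨u, hu0, hu⟩ := Matrix.exists_mulVec_eq_zero_iff.2 (Matrix.exists_vecMul_eq_zero_iff.1 hrow)
  obtain ⟨b, hb⟩ := IsLocalization.exist_integer_multiples_of_finite (nonZeroDivisors (SS n)) u
  choose r hr using hb
  have hb0 : toF (b : SS n) ≠ 0 := fun hb =>
    nonZeroDivisors.ne_zero b.2 (toF_eq_zero.1 hb)
  have hr' : ∀ s, toF (r s) = toF (b : SS n) * u s := fun s => by
    have := hr s
    rwa [Algebra.smul_def] at this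
  set θ : DerF n := ∑ s, toF (r s) • C.dX s with hθ
  have hθX : ∀ i, θ (XF i) = toF (r i) := fun i => by
    rw [hθ, derF_sum_apply, Finset.sum_eq_single i]
    · rw [derF_smul_apply, C.dX_eq, if_pos rfl, mul_one]
    · intro j _ hj; rw [derF_smul_apply, C.dX_eq, if_neg hj, mul_zero]
    · simp
  have hθ0 : θ = 0 := hζ.2.2.2.injOn (fun i => ⟨r i, hθX i⟩)
    (fun i => ⟨0, by rw [toF_zero]; rfl⟩) (by
      rw [nabla_zero]
      refine derF_ext fun i => ?_
      rw [C.nabla_eq, hθ, derF_sum_apply]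
      have h1 := congrFun hu i
      simp only [derF_smul_apply, hr', mul_assoc, ← Finset.mul_sum]
      rw [Derivation.zero_apply, mul_eq_zero]
      right
      simpa [Matrix.mulVec, dotProduct, hM, mul_comm] using h1)
  refine hu0 (funext fun i => ?_)
  have h1 := hθX i
  rw [hθ0, hr'] at h1
  exact (mul_eq_zero.1 h1.symm).resolve_left hb0

theorem iterate_nablaDinv {ζ : DerF n} (h1 : ζ ∈ C.Dinf) (h2 : invDer C ζ) (k : ℕ) :
    C.nablaDinv^[k] ζ ∈ C.Dinf ∧ invDer C (C.nablaDinv^[k] ζ) := by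
  induction k with
  | zero => exact ⟨h1, h2⟩
  | succ k ih =>
    rw [Function.iterate_succ_apply']
    have h := C.nablaDinv_spec _ ih.1 ih.2
    exact ⟨h.1, h.2.1⟩

theorem Dprim_iterate_nablaDinv {ζ : DerF n} (h1 : ζ ∈ C.Dinf) (h2 : invDer C ζ) (k : ℕ)
    (i : Fin n) : Dprim C (C.nablaDinv^[k + 1] ζ (XF i)) = C.nablaDinv^[k] ζ (XF i) := by
  have ih := C.iterate_nablaDinv h1 h2 k
  have h := (C.nablaDinv_spec _ ih.1 ih.2).2.2.1
  rw [Function.iterate_succ_apply', Dprim, ← C.nabla_eq, h]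

variable {C} in
theorem eq_zero_of_relation {m : hyp → ℤ} {ζ : DerF n} (hζ : isUniversal C m ζ)
    (c : ℕ → Fin n → C.Tring) (K : ℕ)
    (hrel : ∀ i, ∑ k ∈ Finset.range (K + 1), ∑ j,
      toF (c k j : SS n) * C.dP j (C.nablaDinv^[k] ζ (XF i)) = 0) : c 0 = 0 := by
  set θ : ℕ → DerF n := fun k => ∑ j, toF (c k j : SS n) • C.dP j with hθdef
  have hθ : ∀ k, C.IsRDer (θ k) := fun k => IsRDer.sum (fun i => (c k i).2.1) C.isRDer_dP
  have hrel' : ∀ i, ∑ k ∈ Finset.range (K + 1), θ k (C.nablaDinv^[k] ζ (XF i)) = 0 := fun i => by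
    rw [← hrel i]
    refine Finset.sum_congr rfl fun k _ => ?_
    rw [hθdef, derF_sum_apply]; rfl
  obtain ⟨N, hNT, hN0, hNdvd⟩ := C.exists_Tker_dvd
  have hreg : ∀ i H, toF N * θ 0 (XF i) ∈ locRing (C.α H) (C.α_prime H) := by
    intro i H
    by_cases hpole : Dprim C (toF (C.α H)) ∈ locRing (C.α H) (C.α_prime H)
    · obtain ⟨q, hq⟩ := hNdvd H hpole
      rw [hq, toF_mul, mul_comm (toF (C.α H)), mul_assoc]
      exact Subring.mul_mem _ (toF_mem_locRing _ _) ((hθ 0).simple_pole_toF H (X i))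
    · refine Subring.mul_mem _ (toF_mem_locRing _ _)
        ((hθ 0).regular_linForms ?_ (X_mem_linForms i))
      refine regular_of_relation C.isRDer_Dprim hpole
        (f := fun k => C.nablaDinv^[k] ζ (toF (C.α H)))
        (linForm_ne_zero_of_isUniversal hζ (C.α_mem H) (C.α_ne H)) (fun k => ?_) (fun k => ?_)
        hθ K ?_
      · have h1 := C.conjDer_apply (C.reflW H) (C.nablaDinv^[k] ζ) (toF (C.α H))
        have h2 := (C.iterate_nablaDinv hζ.1 hζ.2.1 k).2 (C.reflW H)
        rw [actDer] at h2
        rw [← h1, h2, C.actF_compat, C.reflW_α, toF_neg, map_neg]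
      · simp only [derF_linForm _ (C.α_mem H), map_sum, Derivation.map_smul,
          C.Dprim_iterate_nablaDinv hζ.1 hζ.2.1]
      · simp only [derF_linForm _ (C.α_mem H), map_sum, Derivation.map_smul]
        rw [Finset.sum_comm]
        refine Finset.sum_eq_zero fun i _ => ?_
        rw [← Finset.smul_sum, hrel', smul_zero]
  have hpoly : IsPolyDer (∑ j, toF (((⟨N, hNT⟩ * c 0 j : C.Tring)) : SS n) • C.dP j) := by
    intro i
    obtain ⟨s, hs⟩ := C.exists_toF_of_local (f := toF N * θ 0 (XF i)) (fun π hπ hna =>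
      Subring.mul_mem _ (toF_mem_locRing _ _) ((hθ 0).regular_away hπ hna (X i))) (hreg i)
    refine ⟨s, ?_⟩
    rw [← hs, hθdef, derF_sum_apply, derF_sum_apply, Finset.mul_sum]
    simp [derF_smul_apply, mul_assoc]
  funext j
  have h1 := C.eq_zero_of_isPolyDer _ hpoly j
  exact (mul_eq_zero.1 h1).resolve_left fun h => hN0 (congrArg Subtype.val h)

variable {C} in
theorem eq_zero_of_relation_of_lt {m : hyp → ℤ} {ζ : DerF n} (hζ : isUniversal C m ζ) (K : ℕ)
    (c : ℕ → Fin n → C.Tring)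
    (hrel : ∀ i, ∑ k ∈ Finset.range K, ∑ j,
      toF (c k j : SS n) * C.dP j (C.nablaDinv^[k] ζ (XF i)) = 0) : ∀ k < K, c k = 0 := by
  induction K generalizing c with
  | zero => intro k hk; exact absurd hk (Nat.not_lt_zero k)
  | succ K ih =>
    have h0 := eq_zero_of_relation hζ c K hrel
    have h1 := ih (fun k => c (k + 1)) fun i => by
      have h2 := hrel i
      rw [Finset.sum_range_succ', h0] at h2
      simp only [Pi.zero_apply, ZeroMemClass.coe_zero, toF_zero, zero_mul,
        Finset.sum_const_zero, add_zero] at h2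
      have h3 := congrArg (Dprim C) h2
      simp only [map_sum, map_zero, Dprim_Tring_mul] at h3
      rw [← h3]
      refine Finset.sum_congr rfl fun k _ => Finset.sum_congr rfl fun j _ => ?_
      rw [← C.Dprim_iterate_nablaDinv hζ.1 hζ.2.1, Dprim, C.dP_commute]
    intro k hk
    cases k with
    | zero => exact h0
    | succ k => exact h1 k (Nat.lt_of_succ_lt_succ hk)

end Universal

end CoxSetup

end Helpers

theorem stmt9 (C : CoxSetup n hn hyp W) (m : hyp → ℤ) (ζ : DerF n)
    (hζ : isUniversal C m ζ) :
    ∀ c : (Fin n × ℕ) →₀ SS n, (∀ x, c x ∈ Tker C) →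
      (c.sum fun x f =>
        toF f • C.nabla (C.dP x.1) (C.nablaDinv^[x.2] ζ)) = 0 →
      c = 0 := by
  classical
  intro c hc hsum
  set K := c.support.sup Prod.snd + 1 with hK
  have hlt : ∀ x ∈ c.support, x.2 < K := fun x hx =>
    Nat.lt_succ_of_le (Finset.le_sup (f := Prod.snd) hx)
  have h := CoxSetup.eq_zero_of_relation_of_lt hζ K (fun k j => ⟨c (j, k), hc (j, k)⟩) fun i => by
    have h1 := DFunLike.congr_fun hsum (XF i)
    rw [Finsupp.sum, derF_sum_apply] at h1
    rw [← Finset.sum_product_right', ← Derivation.zero_apply (R := ℝ) (XF i), ← h1]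
    refine (Finset.sum_subset (fun x hx => ?_) fun x _ hx => ?_).symm.trans
      (Finset.sum_congr rfl fun x _ => ?_)
    · exact Finset.mem_product.2 ⟨Finset.mem_univ _, Finset.mem_range.2 (hlt x hx)⟩
    · change toF (c x) * _ = 0
      rw [Finsupp.notMem_support_iff.1 hx, toF_zero, zero_mul]
    · rw [derF_smul_apply, C.nabla_eq]
  ext1 x
  by_contra hx
  have hx' := hlt x (Finsupp.mem_support_iff.2 hx)
  exact hx (congrArg Subtype.val (congrFun (h x.2 hx') x.1))

end
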